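/- There exists an absolute constant γ₀ > 0 such that for every γ > γ₀ there is no unidirectional solitary wave solution (ψ, η, r) with Bernoulli constant r = R(0) = γ + √(2/γ). -/

import Mathlib

noncomputable section

open Real Set

/-- Partial derivative of `ψ` in the horizontal variable. -/
def px (ψ : ℝ → ℝ → ℝ) (x y : ℝ) : ℝ := deriv (fun t => ψ t y) x

/-- Partial derivative of `ψ` in the vertical variable. -/
def py (ψ : ℝ → ℝ → ℝ) (x y : ℝ) : ℝ := deriv (fun t => ψ x t) y

/-- Second partial derivative in `x`. -/
def pxx (ψ : ℝ → ℝ → ℝ) (x y : ℝ) : ℝ := deriv (fun t => px ψ t y) x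

/-- Second partial derivative in `y`. -/
def pyy (ψ : ℝ → ℝ → ℝ) (x y : ℝ) : ℝ := deriv (fun t => py ψ x t) y

/-- Depth `d(s)` of the laminar (stream) flow with surface value `s` of `ψ_y`. -/
def lamDepth (γ s : ℝ) : ℝ := (-s + Real.sqrt (s ^ 2 + 2 * γ)) / γ

/-- Bernoulli constant `R(s) = ½ s² + γ + d(s)` of the laminar flow. -/
def bernR (γ s : ℝ) : ℝ := s ^ 2 / 2 + γ + lamDepth γ s

/-- `s` is the (unique) positive critical point `s_c` of `R`, characterized by the
equation `s - 1/γ + s/(γ √(s² + 2γ)) = 0`. -/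
def IsCrit (γ s : ℝ) : Prop :=
  0 < s ∧ s - 1 / γ + s / (γ * Real.sqrt (s ^ 2 + 2 * γ)) = 0

/-- A solution `(ψ, η, r)` of the stream-function formulation with constant adverse
vorticity `ω = -γ`:  `Δψ = γ` in the fluid domain `D_η`, the Bernoulli condition on the
surface, `ψ = 1` on the surface and `ψ = 0` on the flat bottom. -/
structure StreamSolution (γ : ℝ) (ψ : ℝ → ℝ → ℝ) (η : ℝ → ℝ) (r : ℝ) : Prop where
  eta_smooth : ContDiff ℝ (⊤ : ℕ∞) η
  eta_pos : ∀ x, 0 < η x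
  psi_smooth : ContDiff ℝ (⊤ : ℕ∞) (fun p : ℝ × ℝ => ψ p.1 p.2)
  laplace : ∀ x y, 0 < y → y < η x → pxx ψ x y + pyy ψ x y = γ
  bernoulli : ∀ x, (px ψ x (η x)) ^ 2 / 2 + (py ψ x (η x)) ^ 2 / 2 + η x = r
  surface_val : ∀ x, ψ x (η x) = 1
  bottom_val : ∀ x, ψ x 0 = 0

/-- The flow is unidirectional: `ψ_y > 0` everywhere in the fluid domain `D_η`. -/
def Unidirectional (ψ : ℝ → ℝ → ℝ) (η : ℝ → ℝ) : Prop :=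
  ∀ x y, 0 < y → y < η x → 0 < py ψ x y

/-- A Stokes wave with half-period `Λ`: the solution is `2Λ`-periodic and even in `x`,
and the surface profile is strictly decreasing from the crest (`x = 0`) to the
trough (`x = Λ`).  Thus `η̂ = max η = η 0` and `η̌ = min η = η Λ`. -/
structure StokesWave (γ : ℝ) (ψ : ℝ → ℝ → ℝ) (η : ℝ → ℝ) (r Λ : ℝ) : Prop where
  sol : StreamSolution γ ψ η r
  lam_pos : 0 < Λ
  eta_periodic : ∀ x, η (x + 2 * Λ) = η x
  eta_even : ∀ x, η (-x) = η x
  psi_periodic : ∀ x y, ψ (x + 2 * Λ) y = ψ x y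
  psi_even : ∀ x y, ψ (-x) y = ψ x y
  eta_anti : StrictAntiOn η (Set.Icc 0 Λ)

/-- A solitary wave (relative to the critical value `sc = s_c` of `γ`): the solution is
even in `x`, the profile is strictly decreasing on `(0, ∞)` and non-constant, and the
flow converges to a supercritical laminar flow `(U(·; s), d(s))` with `s > s_c`,
`R(s) = r` as `|x| → ∞`.  The crest is at `x = 0`, `η̂ = η 0` and `η̌ = inf η = d(s)`. -/
structure SolitaryWave (γ sc : ℝ) (ψ : ℝ → ℝ → ℝ) (η : ℝ → ℝ) (r : ℝ) : Prop where
  sol : StreamSolution γ ψ η r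
  eta_even : ∀ x, η (-x) = η x
  psi_even : ∀ x y, ψ (-x) y = ψ x y
  eta_anti : StrictAntiOn η (Set.Ioi 0)
  nonconst : ∃ x₁ x₂, η x₁ ≠ η x₂
  asymptotic : ∃ s, sc < s ∧ bernR γ s = r ∧
    ∀ ε > 0, ∃ X : ℝ, ∀ x : ℝ, X ≤ |x| →
      |η x - lamDepth γ s| ≤ ε ∧
      ∀ y ∈ Set.Icc 0 (η x), |px ψ x y| + |py ψ x y - (γ * y + s)| ≤ ε



/-- Smoothness of a curried function of two variables. -/
def Sm (f : ℝ → ℝ → ℝ) : Prop := ContDiff ℝ (⊤ : ℕ∞) (fun p : ℝ × ℝ => f p.1 p.2)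

theorem Sm.hasFD {f} (hf : Sm f) (p : ℝ × ℝ) :
    HasFDerivAt (fun p : ℝ × ℝ => f p.1 p.2) (fderiv ℝ (fun p : ℝ × ℝ => f p.1 p.2) p) p :=
  (ContDiff.differentiable hf (by simp) p).hasFDerivAt

theorem Sm.px_eq {f} (hf : Sm f) (x y : ℝ) :
    px f x y = fderiv ℝ (fun p : ℝ × ℝ => f p.1 p.2) (x, y) (1, 0) := by
  have h := (hf.hasFD (x, y)).comp_hasDerivAt x
    ((hasDerivAt_id x).prodMk (hasDerivAt_const x y))
  exact h.deriv

theorem Sm.py_eq {f} (hf : Sm f) (x y : ℝ) :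
    py f x y = fderiv ℝ (fun p : ℝ × ℝ => f p.1 p.2) (x, y) (0, 1) := by
  have h := (hf.hasFD (x, y)).comp_hasDerivAt y
    ((hasDerivAt_const y x).prodMk (hasDerivAt_id y))
  exact h.deriv

theorem Sm.chain {f} (hf : Sm f) {a b : ℝ → ℝ} {a' b' t : ℝ} (ha : HasDerivAt a a' t)
    (hb : HasDerivAt b b' t) :
    HasDerivAt (fun t => f (a t) (b t)) (px f (a t) (b t) * a' + py f (a t) (b t) * b') t := by
  have h := (hf.hasFD (a t, b t)).comp_hasDerivAt t (ha.prodMk hb)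
  refine h.congr_deriv ?_
  rw [hf.px_eq, hf.py_eq]
  have : ((a', b') : ℝ × ℝ) = a' • ((1:ℝ), (0:ℝ)) + b' • ((0:ℝ), (1:ℝ)) := by
    ext <;> simp
  rw [this, map_add, map_smul, map_smul]
  simp only [smul_eq_mul]; ring

theorem Sm.dx {f} (hf : Sm f) (x y : ℝ) : HasDerivAt (fun t => f t y) (px f x y) x := by
  have := hf.chain (hasDerivAt_id x) (hasDerivAt_const x y)
  simpa using this

theorem Sm.dy {f} (hf : Sm f) (x y : ℝ) : HasDerivAt (fun t => f x t) (py f x y) y := by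
  have := hf.chain (hasDerivAt_const y x) (hasDerivAt_id y)
  simpa using this

theorem Sm.px {f} (hf : Sm f) : Sm (px f) := by
  have h : ContDiff ℝ (⊤ : ℕ∞) (fderiv ℝ (fun p : ℝ × ℝ => f p.1 p.2)) :=
    ContDiff.fderiv_right hf (by simp)
  have : (fun p : ℝ × ℝ => _root_.px f p.1 p.2) =
      fun p => fderiv ℝ (fun p : ℝ × ℝ => f p.1 p.2) p (1, 0) := by
    ext p; exact hf.px_eq p.1 p.2
  unfold Sm
  rw [this]
  exact h.clm_apply contDiff_const

theorem Sm.py {f} (hf : Sm f) : Sm (py f) := by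
  have h : ContDiff ℝ (⊤ : ℕ∞) (fderiv ℝ (fun p : ℝ × ℝ => f p.1 p.2)) :=
    ContDiff.fderiv_right hf (by simp)
  have : (fun p : ℝ × ℝ => _root_.py f p.1 p.2) =
      fun p => fderiv ℝ (fun p : ℝ × ℝ => f p.1 p.2) p (0, 1) := by
    ext p; exact hf.py_eq p.1 p.2
  unfold Sm
  rw [this]
  exact h.clm_apply contDiff_const

theorem Sm.cont {f} (hf : Sm f) : Continuous (fun p : ℝ × ℝ => f p.1 p.2) :=
  ContDiff.continuous hf

theorem Sm.comm {f} (hf : Sm f) (x y : ℝ) :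
    _root_.px (_root_.py f) x y = _root_.py (_root_.px f) x y := by
  have hs : IsSymmSndFDerivAt ℝ (fun p : ℝ × ℝ => f p.1 p.2) (x, y) :=
    (ContDiff.contDiffAt hf).isSymmSndFDerivAt (by simp; exact WithTop.coe_le_coe.2 le_top)
  have h : ContDiff ℝ (⊤ : ℕ∞) (fderiv ℝ (fun p : ℝ × ℝ => f p.1 p.2)) :=
    ContDiff.fderiv_right hf (by simp)
  have hd := h.differentiable (by simp) (x, y)
  have e1 : (fun p : ℝ × ℝ => _root_.py f p.1 p.2) =
      fun p => fderiv ℝ (fun p : ℝ × ℝ => f p.1 p.2) p (0, 1) := by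
    ext p; exact hf.py_eq p.1 p.2
  have e2 : (fun p : ℝ × ℝ => _root_.px f p.1 p.2) =
      fun p => fderiv ℝ (fun p : ℝ × ℝ => f p.1 p.2) p (1, 0) := by
    ext p; exact hf.px_eq p.1 p.2
  rw [hf.py.px_eq, hf.px.py_eq, e1, e2, fderiv_clm_apply hd (differentiableAt_const _),
    fderiv_clm_apply hd (differentiableAt_const _)]
  simpa using hs (1, 0) (0, 1)

open MeasureTheory in
/-- Differentiation under an integral with fixed limits. -/
theorem param_deriv {F F' : ℝ → ℝ → ℝ} (hF : Continuous (fun p : ℝ × ℝ => F p.1 p.2))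
    (hF' : Continuous (fun p : ℝ × ℝ => F' p.1 p.2))
    (hd : ∀ x t, HasDerivAt (fun x => F x t) (F' x t) x) (a b x₀ : ℝ) :
    HasDerivAt (fun x => ∫ t in a..b, F x t) (∫ t in a..b, F' x₀ t) x₀ := by
  obtain ⟨C, hC⟩ := (((isCompact_closedBall x₀ 1).prod (isCompact_uIcc (a := a) (b := b))).exists_bound_of_continuousOn hF'.continuousOn)
  have hc : ∀ x, Continuous (F x) := fun x => hF.comp (by fun_prop : Continuous fun t : ℝ => (x, t))
  have hc' : ∀ x, Continuous (F' x) := fun x => hF'.comp (by fun_prop : Continuous fun t : ℝ => (x, t))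
  refine (intervalIntegral.hasDerivAt_integral_of_dominated_loc_of_deriv_le (bound := fun _ => C)
    (Metric.closedBall_mem_nhds x₀ one_pos) ?_ ?_ ?_ ?_ ?_ ?_).2
  · exact Filter.Eventually.of_forall fun x => (hc x).aestronglyMeasurable
  · exact (hc x₀).intervalIntegrable _ _
  · exact (hc' x₀).aestronglyMeasurable
  · exact Filter.Eventually.of_forall fun t ht x hx => hC (x, t) ⟨hx, uIoc_subset_uIcc ht⟩
  · exact intervalIntegrable_const
  · exact Filter.Eventually.of_forall fun t ht x hx => hd x t



theorem Sm.add {f g} (hf : Sm f) (hg : Sm g) : Sm (fun x y => f x y + g x y) := ContDiff.add hf hg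
theorem Sm.sub {f g} (hf : Sm f) (hg : Sm g) : Sm (fun x y => f x y - g x y) := ContDiff.sub hf hg
theorem Sm.mul {f g} (hf : Sm f) (hg : Sm g) : Sm (fun x y => f x y * g x y) := ContDiff.mul hf hg
theorem Sm.neg {f} (hf : Sm f) : Sm (fun x y => -f x y) := ContDiff.neg hf
theorem Sm.ofY {g : ℝ → ℝ} (hg : ContDiff ℝ (⊤ : ℕ∞) g) : Sm (fun _ y => g y) :=
  hg.comp contDiff_snd

theorem Sm.contXY {f} (hf : Sm f) {a b : ℝ → ℝ} (ha : Continuous a) (hb : Continuous b) :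
    Continuous (fun t => f (a t) (b t)) := hf.cont.comp (ha.prodMk hb)

theorem Sm.contY {f} (hf : Sm f) (x : ℝ) : Continuous (f x) := hf.contXY continuous_const continuous_id

/-- Flux lemma. -/
theorem flux {F G : ℝ → ℝ → ℝ} {η : ℝ → ℝ} (hF : Sm F) (hG : Sm G) (hη : ContDiff ℝ (⊤ : ℕ∞) η)
    (h0 : ∀ x, 0 ≤ η x)
    (hdiv : ∀ x y, 0 ≤ y → y ≤ η x → px F x y + py G x y = 0) (x : ℝ) :
    HasDerivAt (fun x => ∫ y in (0:ℝ)..η x, F x y)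
      (F x (η x) * deriv η x - G x (η x) + G x 0) x := by
  have hηd : ∀ x, HasDerivAt η (deriv η x) x := fun x => (hη.differentiable (by simp) x).hasDerivAt
  have hηc : Continuous η := hη.continuous
  have hη'c : Continuous (deriv η) := hη.continuous_deriv (by simp)
  have e : (fun x => ∫ y in (0:ℝ)..η x, F x y) = fun x => ∫ t in (0:ℝ)..1, η x * F x (η x * t) := by
    ext x
    rw [intervalIntegral.integral_const_mul]
    have := intervalIntegral.smul_integral_comp_mul_left (a := 0) (b := 1) (F x) (η x)
    simp only [smul_eq_mul, mul_zero, mul_one] at this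
    exact this.symm
  rw [e]
  have hd := param_deriv (F := fun x t => η x * F x (η x * t))
    (F' := fun x t => deriv η x * F x (η x * t) +
      η x * (px F x (η x * t) * 1 + py F x (η x * t) * (deriv η x * t)))
    (by
      have := hF.cont.comp (by fun_prop : Continuous (fun p : ℝ × ℝ => (p.1, η p.1 * p.2)))
      exact (hηc.comp continuous_fst).mul this)
    (by
      have h1 := hF.cont.comp (by fun_prop : Continuous (fun p : ℝ × ℝ => (p.1, η p.1 * p.2)))
      have h2 := hF.px.cont.comp (by fun_prop : Continuous (fun p : ℝ × ℝ => (p.1, η p.1 * p.2)))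
      have h3 := hF.py.cont.comp (by fun_prop : Continuous (fun p : ℝ × ℝ => (p.1, η p.1 * p.2)))
      exact ((hη'c.comp continuous_fst).mul h1).add ((hηc.comp continuous_fst).mul
        ((h2.mul continuous_const).add (h3.mul ((hη'c.comp continuous_fst).mul continuous_snd)))))
    (by
      intro x t
      exact (hηd x).mul (hF.chain (hasDerivAt_id x) ((hηd x).mul_const t)))
    0 1 x
  refine hd.congr_deriv ?_
  have hft : ∀ t ∈ uIcc (0:ℝ) 1, HasDerivAt
      (fun t => deriv η x * t * F x (η x * t) - G x (η x * t))
      (deriv η x * F x (η x * t) +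
      η x * (px F x (η x * t) * 1 + py F x (η x * t) * (deriv η x * t))) t := by
    intro t ht
    rw [uIcc_of_le zero_le_one] at ht
    have hm : HasDerivAt (fun t => η x * t) (η x) t := by
      simpa using (hasDerivAt_id t).const_mul (η x)
    have hm' : HasDerivAt (fun t => deriv η x * t) (deriv η x) t := by
      simpa using (hasDerivAt_id t).const_mul (deriv η x)
    have h1 := (hm'.mul (hF.chain (hasDerivAt_const t x) hm)).sub
      (hG.chain (hasDerivAt_const t x) hm)
    refine h1.congr_deriv ?_
    have := hdiv x (η x * t) (mul_nonneg (h0 x) ht.1) (mul_le_of_le_one_right (h0 x) ht.2)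
    have e2 : px F x (η x * t) = - py G x (η x * t) := by linarith
    rw [e2]; ring
  rw [intervalIntegral.integral_eq_sub_of_hasDerivAt hft]
  · simp; ring
  · apply Continuous.intervalIntegrable
    have h1 := hF.contXY continuous_const (by fun_prop : Continuous (fun t : ℝ => η x * t)) (a := fun _ => x)
    have h2 := hF.px.contXY continuous_const (by fun_prop : Continuous (fun t : ℝ => η x * t)) (a := fun _ => x)
    have h3 := hF.py.contXY continuous_const (by fun_prop : Continuous (fun t : ℝ => η x * t)) (a := fun _ => x)
    exact (continuous_const.mul h1).add (continuous_const.mul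
        ((h2.mul continuous_const).add (h3.mul (continuous_const.mul continuous_id))))

theorem second_deriv_nonneg {f : ℝ → ℝ} {x : ℝ} (h : IsLocalMin f x) (hc : ContinuousAt f x) :
    0 ≤ deriv (deriv f) x := by
  by_contra hlt
  push Not at hlt
  have hmax := isLocalMax_of_deriv_deriv_neg hlt h.deriv_eq_zero hc
  have he : f =ᶠ[nhds x] fun _ => f x := by
    filter_upwards [h, hmax] with y h1 h2
    exact le_antisymm h2 h1
  have : deriv (deriv f) x = 0 := by
    rw [he.deriv.deriv_eq]; simp
  linarith

theorem min_principle {H : ℝ → ℝ → ℝ} (hH : Sm H) {K : Set (ℝ × ℝ)} (hK : IsCompact K) {ε : ℝ}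
    (h : ∀ p ∈ K, -ε ≤ H p.1 p.2 ∨ (K ∈ nhds p ∧ pxx H p.1 p.2 + pyy H p.1 p.2 = 0)) :
    ∀ p ∈ K, -ε ≤ H p.1 p.2 := by
  intro p hp
  obtain ⟨B, hB⟩ := hK.exists_bound_of_continuousOn
    (by fun_prop : Continuous (fun p : ℝ × ℝ => p.2 ^ 2)).continuousOn
  have hB0 : 0 ≤ B := (norm_nonneg _).trans (hB p hp)
  have key : ∀ δ > 0, -ε - δ * B ≤ H p.1 p.2 := by
    intro δ hδ
    have hcont : Continuous (fun q : ℝ × ℝ => H q.1 q.2 - δ * q.2 ^ 2) := by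
      have := hH.cont; fun_prop
    obtain ⟨q, hq, hmin⟩ := hK.exists_isMinOn ⟨p, hp⟩ hcont.continuousOn
    have hpq : H q.1 q.2 - δ * q.2 ^ 2 ≤ H p.1 p.2 - δ * p.2 ^ 2 := hmin hp
    rcases h q hq with h1 | ⟨hn, hl⟩
    · have := hB q hq
      rw [Real.norm_of_nonneg (sq_nonneg _)] at this
      nlinarith [sq_nonneg p.2]
    · exfalso
      have hloc : IsLocalMin (fun q : ℝ × ℝ => H q.1 q.2 - δ * q.2 ^ 2) q := hmin.isLocalMin hn
      have c1 : ContinuousAt (fun t : ℝ => (t, q.2)) q.1 := by fun_prop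
      have c2 : ContinuousAt (fun t : ℝ => (q.1, t)) q.2 := by fun_prop
      have l1 : IsLocalMin (fun t => H t q.2 - δ * q.2 ^ 2) q.1 := c1.eventually hloc
      have l2 : IsLocalMin (fun t => H q.1 t - δ * t ^ 2) q.2 := c2.eventually hloc
      have d1 := second_deriv_nonneg l1 ((hcont.comp (by fun_prop : Continuous fun t : ℝ => (t, q.2))).continuousAt)
      have d2 := second_deriv_nonneg l2 ((hcont.comp (by fun_prop : Continuous fun t : ℝ => (q.1, t))).continuousAt)
      have e1 : deriv (fun t => H t q.2 - δ * q.2 ^ 2) = fun t => px H t q.2 := by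
        ext t; exact ((hH.dx t q.2).sub_const _).deriv
      have e2 : deriv (fun t => H q.1 t - δ * t ^ 2) = fun t => py H q.1 t - δ * (2 * t) := by
        ext t
        refine ((hH.dy q.1 t).sub ((hasDerivAt_pow 2 t).const_mul δ)).deriv.trans ?_
        simp
      rw [e1] at d1
      have e3 : deriv (fun t => py H q.1 t - δ * (2 * t)) q.2 = pyy H q.1 q.2 - δ * 2 := by
        refine ((hH.py.dy q.1 q.2).sub (((hasDerivAt_id q.2).const_mul 2).const_mul δ)).deriv.trans ?_
        simp [pyy, py]
      rw [e2, e3] at d2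
      have : deriv (fun t => px H t q.2) q.1 = pxx H q.1 q.2 := rfl
      linarith
  by_contra hlt
  push Not at hlt
  have := key ((-ε - H p.1 p.2) / (2 * (B + 1))) (by apply div_pos <;> linarith)
  have h2 : (-ε - H p.1 p.2) / (2 * (B + 1)) * B ≤ (-ε - H p.1 p.2) / 2 := by
    rw [div_mul_eq_mul_div, div_le_div_iff₀ (by linarith) (by norm_num)]
    nlinarith
  linarith



theorem Sm.polc {f} (hf : Sm f) (X : ℝ) :
    Continuous (fun p : ℝ × ℝ => f (X + p.1 * cos p.2) (p.1 * sin p.2)) :=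
  hf.cont.comp (by fun_prop : Continuous (fun p : ℝ × ℝ => (X + p.1 * cos p.2, p.1 * sin p.2)))

theorem Sm.polt {f} (hf : Sm f) (X r : ℝ) :
    Continuous (fun θ : ℝ => f (X + r * cos θ) (r * sin θ)) :=
  hf.contXY (by fun_prop) (by fun_prop)

theorem Sm.pol_r {f} (hf : Sm f) (X r θ : ℝ) :
    HasDerivAt (fun r => f (X + r * cos θ) (r * sin θ))
      (_root_.px f (X + r * cos θ) (r * sin θ) * cos θ + _root_.py f (X + r * cos θ) (r * sin θ) * sin θ) r := by
  have h1 : HasDerivAt (fun r => X + r * cos θ) (cos θ) r := by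
    simpa using ((hasDerivAt_id r).mul_const (cos θ)).const_add X
  have h2 : HasDerivAt (fun r => r * sin θ) (sin θ) r := by
    simpa using ((hasDerivAt_id r).mul_const (sin θ))
  exact hf.chain h1 h2

theorem Sm.pol_t {f} (hf : Sm f) (X r θ : ℝ) :
    HasDerivAt (fun θ => f (X + r * cos θ) (r * sin θ))
      (r * (_root_.py f (X + r * cos θ) (r * sin θ) * cos θ - _root_.px f (X + r * cos θ) (r * sin θ) * sin θ)) θ := by
  have h1 : HasDerivAt (fun θ => X + r * cos θ) (r * -sin θ) θ :=
    ((hasDerivAt_cos θ).const_mul r).const_add X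
  have h2 : HasDerivAt (fun θ => r * sin θ) (r * cos θ) θ := (hasDerivAt_sin θ).const_mul r
  refine (hf.chain h1 h2).congr_deriv ?_
  ring

/-- half-circle hypotheses -/
structure HalfDisc (u : ℝ → ℝ → ℝ) (X d : ℝ) : Prop where
  sm : Sm u
  bot : ∀ x, u x 0 = 0
  harm : ∀ x y, 0 ≤ y → (x - X) ^ 2 + y ^ 2 ≤ d ^ 2 → pxx u x y + pyy u x y = 0

theorem px_bot {u : ℝ → ℝ → ℝ} (h : ∀ x, u x 0 = 0) (x : ℝ) : px u x 0 = 0 := by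
  simp [px, h]

theorem hasDerivAt_sin_nat (m θ : ℝ) : HasDerivAt (fun θ => sin (m * θ)) (m * cos (m * θ)) θ := by
  have := ((hasDerivAt_id θ).const_mul m).sin
  simpa [mul_comm] using this

theorem hasDerivAt_cos_nat (m θ : ℝ) : HasDerivAt (fun θ => cos (m * θ)) (-(m * sin (m * θ))) θ := by
  have := ((hasDerivAt_id θ).const_mul m).cos
  simpa [mul_comm] using this

theorem HalfDisc.K_zero {u X d} (h : HalfDisc u X d) (m : ℕ) (hm : m ≠ 0) {r : ℝ} (hr : 0 < r)
    (hrd : r ≤ d) :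
    ∫ θ in (0:ℝ)..π, (px u (X + r * cos θ) (r * sin θ) * sin (m * θ) -
      py u (X + r * cos θ) (r * sin θ) * cos (m * θ)) = 0 := by
  set K : ℝ → ℝ := fun r => ∫ θ in (0:ℝ)..π, (px u (X + r * cos θ) (r * sin θ) * sin (m * θ) -
      py u (X + r * cos θ) (r * sin θ) * cos (m * θ)) with hK
  have hp := h.sm.px
  have hq := h.sm.py
  have hKd : ∀ r, HasDerivAt K (∫ θ in (0:ℝ)..π,
      ((px (px u) (X + r * cos θ) (r * sin θ) * cos θ + py (px u) (X + r * cos θ) (r * sin θ) * sin θ)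
        * sin (m * θ) -
      (px (py u) (X + r * cos θ) (r * sin θ) * cos θ + py (py u) (X + r * cos θ) (r * sin θ) * sin θ)
        * cos (m * θ))) r := by
    intro r
    refine param_deriv (F := fun r θ => px u (X + r * cos θ) (r * sin θ) * sin (m * θ) -
      py u (X + r * cos θ) (r * sin θ) * cos (m * θ)) (F' := fun r θ =>
      (px (px u) (X + r * cos θ) (r * sin θ) * cos θ + py (px u) (X + r * cos θ) (r * sin θ) * sin θ)
        * sin (m * θ) -
      (px (py u) (X + r * cos θ) (r * sin θ) * cos θ + py (py u) (X + r * cos θ) (r * sin θ) * sin θ)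
        * cos (m * θ)) ?_ ?_ ?_ 0 π r
    · have := hp.polc X; have := hq.polc X; fun_prop
    · have := hp.px.polc X; have := hq.px.polc X; have := hp.py.polc X; have := hq.py.polc X
      fun_prop
    · intro r θ
      exact ((hp.pol_r X r θ).mul_const _).sub ((hq.pol_r X r θ).mul_const _)
  have hode : ∀ r, 0 ≤ r → r ≤ d → r * deriv K r + m * K r = 0 := by
    intro r hr hrd
    rw [(hKd r).deriv, hK]
    simp only
    rw [← intervalIntegral.integral_const_mul, ← intervalIntegral.integral_const_mul,
      ← intervalIntegral.integral_add]
    · have hB : ∀ θ ∈ uIcc (0:ℝ) π, HasDerivAt (fun θ =>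
          -(py u (X + r * cos θ) (r * sin θ) * sin (m * θ) +
            px u (X + r * cos θ) (r * sin θ) * cos (m * θ)))
          (r * ((px (px u) (X + r * cos θ) (r * sin θ) * cos θ
            + py (px u) (X + r * cos θ) (r * sin θ) * sin θ) * sin (m * θ) -
            (px (py u) (X + r * cos θ) (r * sin θ) * cos θ
            + py (py u) (X + r * cos θ) (r * sin θ) * sin θ) * cos (m * θ)) +
            m * (px u (X + r * cos θ) (r * sin θ) * sin (m * θ) -
      py u (X + r * cos θ) (r * sin θ) * cos (m * θ))) θ := by
        intro θ hθ
        rw [uIcc_of_le pi_pos.le] at hθ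
        have h1 := (((hq.pol_t X r θ).mul (hasDerivAt_sin_nat m θ)).add
          ((hp.pol_t X r θ).mul (hasDerivAt_cos_nat m θ))).neg
        refine h1.congr_deriv ?_
        have hs := sin_nonneg_of_mem_Icc hθ
        have e1 := h.harm (X + r * cos θ) (r * sin θ) (mul_nonneg hr hs) (by
          have : (X + r * cos θ - X) ^ 2 + (r * sin θ) ^ 2 = r ^ 2 * (sin θ ^ 2 + cos θ ^ 2) := by ring
          rw [this, sin_sq_add_cos_sq, mul_one]
          exact pow_le_pow_left₀ hr hrd 2)
        have e1 : px (px u) (X + r * cos θ) (r * sin θ) = - py (py u) (X + r * cos θ) (r * sin θ) := by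
          have : px (px u) (X + r * cos θ) (r * sin θ) + py (py u) (X + r * cos θ) (r * sin θ) = 0 := e1
          linarith
        have e2 := h.sm.comm (X + r * cos θ) (r * sin θ)
        rw [e1, ← e2]
        ring
      rw [intervalIntegral.integral_eq_sub_of_hasDerivAt hB]
      · simp [sin_nat_mul_pi, px_bot h.bot]
      · apply Continuous.intervalIntegrable
        have := hp.px.polt X r; have := hq.px.polt X r; have := hp.py.polt X r
        have := hq.py.polt X r; have := hp.polt X r; have := hq.polt X r
        fun_prop
    · apply Continuous.intervalIntegrable
      have := hp.px.polt X r; have := hq.px.polt X r; have := hp.py.polt X r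
      have := hq.py.polt X r
      fun_prop
    · apply Continuous.intervalIntegrable
      have := hp.polt X r; have := hq.polt X r
      fun_prop
  have hd : ∀ r, HasDerivAt (fun r => r ^ m * K r) (m * r ^ (m - 1) * K r + r ^ m * deriv K r) r := by
    intro r
    exact (hasDerivAt_pow m r).mul ((hKd r).differentiableAt.hasDerivAt)
  have hc := constant_of_has_deriv_right_zero (f := fun r => r ^ m * K r) (a := 0) (b := r)
    (fun r _ => (hd r).continuousAt.continuousWithinAt) (by
      intro x hx
      refine (hd x).hasDerivWithinAt.congr_deriv ?_
      have e := hode x hx.1 (hx.2.le.trans hrd)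
      obtain ⟨j, rfl⟩ := Nat.exists_eq_succ_of_ne_zero hm
      simp only [Nat.succ_eq_add_one, Nat.add_sub_cancel] at *
      rw [pow_succ]
      linear_combination x ^ j * e) r ⟨hr.le, le_rfl⟩
  simp only [ne_eq, hm, not_false_eq_true, zero_pow, zero_mul] at hc
  rcases mul_eq_zero.1 hc with h1 | h1
  · exact absurd h1 (pow_ne_zero _ hr.ne')
  · exact h1

/-- moment of `u` -/
def mom (u : ℝ → ℝ → ℝ) (X : ℝ) (n : ℕ) (r : ℝ) : ℝ :=
  ∫ θ in (0:ℝ)..π, u (X + r * cos θ) (r * sin θ) * sin (n * θ)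

def mom' (u : ℝ → ℝ → ℝ) (X : ℝ) (n : ℕ) (r : ℝ) : ℝ :=
  ∫ θ in (0:ℝ)..π, (px u (X + r * cos θ) (r * sin θ) * cos θ +
    py u (X + r * cos θ) (r * sin θ) * sin θ) * sin (n * θ)

theorem mom_deriv {u} (hu : Sm u) (X : ℝ) (n : ℕ) (r : ℝ) :
    HasDerivAt (mom u X n) (mom' u X n r) r := by
  refine param_deriv (F := fun r θ => u (X + r * cos θ) (r * sin θ) * sin (n * θ))
    (F' := fun r θ => (px u (X + r * cos θ) (r * sin θ) * cos θ +
      py u (X + r * cos θ) (r * sin θ) * sin θ) * sin (n * θ)) ?_ ?_ ?_ 0 π r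
  · exact (hu.polc X).mul (by fun_prop)
  · have := hu.px.polc X; have := hu.py.polc X; fun_prop
  · intro r θ; exact (hu.pol_r X r θ).mul_const _

theorem HalfDisc.mom_ode {u X d} (h : HalfDisc u X d) (n : ℕ) {r : ℝ} (hr : 0 < r)
    (hrd : r ≤ d) : r * mom' u X n r = n * mom u X n r := by
  have hK := h.K_zero (n + 1) (by simp) hr hrd
  have hB : ∀ θ ∈ uIcc (0:ℝ) π, HasDerivAt (fun θ =>
      u (X + r * cos θ) (r * sin θ) * cos (n * θ))
      (r * ((px u (X + r * cos θ) (r * sin θ) * cos θ +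
      py u (X + r * cos θ) (r * sin θ) * sin θ) * sin (n * θ))
       - n * (u (X + r * cos θ) (r * sin θ) * sin (n * θ))
       - r * (px u (X + r * cos θ) (r * sin θ) * sin ((n + 1 : ℕ) * θ) -
      py u (X + r * cos θ) (r * sin θ) * cos ((n + 1 : ℕ) * θ))) θ := by
    intro θ hθ
    refine ((h.sm.pol_t X r θ).mul (hasDerivAt_cos_nat n θ)).congr_deriv ?_
    have e : ((n + 1 : ℕ) : ℝ) * θ = n * θ + θ := by push_cast; ring
    rw [e, sin_add, cos_add]
    ring
  have hc0 := h.sm.polt X r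
  have hc1 := h.sm.px.polt X r
  have hc2 := h.sm.py.polt X r
  have k1 : Continuous (fun θ => r * ((px u (X + r * cos θ) (r * sin θ) * cos θ +
      py u (X + r * cos θ) (r * sin θ) * sin θ) * sin (n * θ))) := by fun_prop
  have k2 : Continuous (fun θ => n * (u (X + r * cos θ) (r * sin θ) * sin (n * θ))) :=
    continuous_const.mul (hc0.mul (by fun_prop))
  have k3 : Continuous (fun θ => r * (px u (X + r * cos θ) (r * sin θ) * sin ((n + 1 : ℕ) * θ) -
      py u (X + r * cos θ) (r * sin θ) * cos ((n + 1 : ℕ) * θ))) := by fun_prop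
  have hI := intervalIntegral.integral_eq_sub_of_hasDerivAt hB
    (((k1.sub k2).sub k3).intervalIntegrable _ _)
  rw [intervalIntegral.integral_sub (by exact (k1.sub k2).intervalIntegrable _ _) (k3.intervalIntegrable _ _),
    intervalIntegral.integral_sub (k1.intervalIntegrable _ _) (k2.intervalIntegrable _ _),
    intervalIntegral.integral_const_mul, intervalIntegral.integral_const_mul,
    intervalIntegral.integral_const_mul, hK] at hI
  simp only [sin_pi, sin_zero, mul_zero, h.bot, zero_mul, sub_zero] at hI
  unfold mom mom'
  linarith

/-- slope lemma -/
theorem ratio_const {h : ℝ → ℝ} {h' c d : ℝ} (hd : 0 < d) (h0 : h 0 = 0) (hh : HasDerivAt h h' 0)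
    (hc : ∀ r, 0 < r → r ≤ d → h r = c * r) : h' = c := by
  have h1 : HasDerivWithinAt h h' (Ioi 0) 0 := hh.hasDerivWithinAt
  have h2 : HasDerivWithinAt h c (Ioi 0) 0 := by
    have : HasDerivWithinAt (fun r => c * r) c (Ioi 0) 0 := by
      simpa using ((hasDerivAt_id (0:ℝ)).const_mul c).hasDerivWithinAt
    refine this.congr_of_eventuallyEq ?_ (by simp [h0])
    filter_upwards [Ioc_mem_nhdsGT hd] with r hr using hc r hr.1 hr.2
  exact (uniqueDiffWithinAt_Ioi (0:ℝ)).eq_deriv _ h1 h2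

theorem HalfDisc.mom_pow {u X d} (h : HalfDisc u X d) (n : ℕ) {r : ℝ} (hr : 0 < r)
    (hrd : r ≤ d) : mom u X n r * d ^ n = mom u X n d * r ^ n := by
  have hd : 0 < d := hr.trans_le hrd
  have hD : ∀ x, 0 < x → HasDerivAt (fun r => mom u X n r / r ^ n)
      ((mom' u X n x * x ^ n - mom u X n x * (n * x ^ (n - 1))) / (x ^ n) ^ 2) x := by
    intro x hx
    exact (mom_deriv h.sm X n x).div (hasDerivAt_pow n x) (pow_ne_zero _ hx.ne')
  have hc := constant_of_has_deriv_right_zero (f := fun r => mom u X n r / r ^ n) (a := r) (b := d)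
    (fun x hx => (hD x (hr.trans_le hx.1)).continuousAt.continuousWithinAt) (by
      intro x hx
      have hx0 := hr.trans_le hx.1
      refine (hD x hx0).hasDerivWithinAt.congr_deriv ?_
      have e := h.mom_ode n hx0 hx.2.le
      rw [div_eq_zero_iff]; left
      rcases n with _ | n
      · have : mom' u X 0 x = 0 := by
          simp only [Nat.cast_zero, zero_mul, mul_eq_zero] at e
          rcases e with e | e
          · exact absurd e hx0.ne'
          · exact e
        simp [this]
      · simp only [Nat.add_sub_cancel, pow_succ]
        linear_combination x ^ n * e) d ⟨hrd, le_rfl⟩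
  have h1 : d ^ n ≠ 0 := pow_ne_zero _ hd.ne'
  have h2 : r ^ n ≠ 0 := pow_ne_zero _ hr.ne'
  field_simp at hc
  linarith

theorem HalfDisc.H1 {u X d} (h : HalfDisc u X d) (hd : 0 < d) :
    ∫ θ in (0:ℝ)..π, u (X + d * cos θ) (d * sin θ) * sin θ = π / 2 * d * py u X 0 := by
  have h0 : mom u X 1 0 = 0 := by simp [mom, h.bot]
  have hc := ratio_const (c := mom u X 1 d / d) hd h0 (mom_deriv h.sm X 1 0) (by
    intro r hr hrd
    have := h.mom_pow 1 hr hrd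
    simp only [pow_one] at this
    field_simp; linarith)
  have e : mom' u X 1 0 = py u X 0 * (π / 2) := by
    have : mom' u X 1 0 = ∫ θ in (0:ℝ)..π, py u X 0 * sin θ ^ 2 := by
      unfold mom'
      apply intervalIntegral.integral_congr
      intro θ _
      simp [px_bot h.bot]; ring
    rw [this, intervalIntegral.integral_const_mul, integral_sin_sq]
    simp
  have e2 : mom u X 1 d = ∫ θ in (0:ℝ)..π, u (X + d * cos θ) (d * sin θ) * sin θ := by
    simp [mom]
  rw [← e2]
  rw [e] at hc
  field_simp at hc ⊢
  linarith

theorem integral_sin_two_sq : ∫ θ in (0:ℝ)..π, sin (2 * θ) ^ 2 = π / 2 := by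
  have h : ∀ θ ∈ uIcc (0:ℝ) π, HasDerivAt (fun θ => θ / 2 - sin (2 * θ) * cos (2 * θ) / 4)
      (sin (2 * θ) ^ 2) θ := by
    intro θ _
    refine (((hasDerivAt_id θ).div_const 2).sub
      (((hasDerivAt_sin_nat 2 θ).mul (hasDerivAt_cos_nat 2 θ)).div_const 4)).congr_deriv ?_
    have := sin_sq_add_cos_sq (2 * θ)
    linear_combination (-1/2) * this
  rw [intervalIntegral.integral_eq_sub_of_hasDerivAt h (by
    apply Continuous.intervalIntegrable; fun_prop)]
  have : sin (2 * π) = 0 := sin_two_pi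
  simp

theorem HalfDisc.H2 {u X d} (h : HalfDisc u X d) (hd : 0 < d) :
    ∫ θ in (0:ℝ)..π, u (X + d * cos θ) (d * sin θ) * sin (2 * θ) = π / 4 * d ^ 2 * px (py u) X 0 := by
  have h0 : mom' u X 2 0 = 0 := by
    unfold mom'
    have : ∀ θ ∈ uIcc (0:ℝ) π, HasDerivAt (fun θ => py u X 0 * (2 / 3) * sin θ ^ 3)
      ((px u (X + 0 * cos θ) (0 * sin θ) * cos θ + py u (X + 0 * cos θ) (0 * sin θ) * sin θ)
        * sin ((2 : ℕ) * θ)) θ := by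
      intro θ _
      refine (((hasDerivAt_sin θ).pow 3).const_mul (py u X 0 * (2 / 3))).congr_deriv ?_
      simp only [zero_mul, add_zero, px_bot h.bot, Nat.cast_ofNat, sin_two_mul]
      ring
    rw [intervalIntegral.integral_eq_sub_of_hasDerivAt this (by
      apply Continuous.intervalIntegrable
      have := h.sm.px.polt X 0; have := h.sm.py.polt X 0; fun_prop)]
    simp
  have hdd : HasDerivAt (mom' u X 2) (px (py u) X 0 * (π / 2)) 0 := by
    have := param_deriv (F := fun r θ => (px u (X + r * cos θ) (r * sin θ) * cos θ +
        py u (X + r * cos θ) (r * sin θ) * sin θ) * sin ((2 : ℕ) * θ))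
      (F' := fun r θ => ((px (px u) (X + r * cos θ) (r * sin θ) * cos θ
          + py (px u) (X + r * cos θ) (r * sin θ) * sin θ) * cos θ +
        (px (py u) (X + r * cos θ) (r * sin θ) * cos θ
          + py (py u) (X + r * cos θ) (r * sin θ) * sin θ) * sin θ) * sin ((2 : ℕ) * θ)) ?_ ?_ ?_ 0 π 0
    · refine this.congr_deriv ?_
      have hxx : px (px u) X 0 = 0 := px_bot (px_bot h.bot) X
      have hyy : py (py u) X 0 = 0 := by
        have := h.harm X 0 le_rfl (by simp; positivity)
        have e : px (px u) X 0 + py (py u) X 0 = 0 := this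
        linarith
      rw [← integral_sin_two_sq, ← intervalIntegral.integral_const_mul]
      apply intervalIntegral.integral_congr
      intro θ _
      simp only [zero_mul, add_zero, hxx, hyy, ← h.sm.comm, Nat.cast_ofNat]
      have : sin (2 * θ) = 2 * sin θ * cos θ := sin_two_mul θ
      rw [this]; ring
    · have := h.sm.px.polc X; have := h.sm.py.polc X; fun_prop
    · have := h.sm.px.px.polc X; have := h.sm.py.px.polc X; have := h.sm.px.py.polc X
      have := h.sm.py.py.polc X; fun_prop
    · intro r θ
      exact (((h.sm.px.pol_r X r θ).mul_const _).add ((h.sm.py.pol_r X r θ).mul_const _)).mul_const _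
  have hc := ratio_const (c := 2 * mom u X 2 d / d ^ 2) hd h0 hdd (by
    intro r hr hrd
    have h1 := h.mom_pow 2 hr hrd
    have h2 := h.mom_ode 2 hr hrd
    push_cast at h2
    have : mom u X 2 r = mom u X 2 d / d ^ 2 * r ^ 2 := by
      field_simp; linarith
    rw [this] at h2
    have h3 : r * mom' u X 2 r = r * (2 * mom u X 2 d / d ^ 2 * r) := by
      rw [h2]; ring
    exact mul_left_cancel₀ hr.ne' h3)
  have e2 : mom u X 2 d = ∫ θ in (0:ℝ)..π, u (X + d * cos θ) (d * sin θ) * sin (2 * θ) := by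
    simp [mom]
  rw [← e2]
  field_simp at hc ⊢
  linarith

/-- Harnack-type bound for the derivative of the bottom slope -/
theorem HalfDisc.harnack {u X d} (h : HalfDisc u X d) (hd : 0 < d)
    (hpos : ∀ x y, 0 ≤ y → (x - X) ^ 2 + y ^ 2 ≤ d ^ 2 → 0 ≤ u x y) :
    |px (py u) X 0| * d ≤ 4 * py u X 0 := by
  have h1 := h.H1 hd
  have h2 := h.H2 hd
  have hc0 := h.sm.polt X d
  have hnn : ∀ θ ∈ Icc 0 π, 0 ≤ u (X + d * cos θ) (d * sin θ) := by
    intro θ hθ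
    apply hpos _ _ (mul_nonneg hd.le (sin_nonneg_of_mem_Icc hθ))
    have : (X + d * cos θ - X) ^ 2 + (d * sin θ) ^ 2 = d ^ 2 * (sin θ ^ 2 + cos θ ^ 2) := by ring
    rw [this, sin_sq_add_cos_sq, mul_one]
  have hb : |∫ θ in (0:ℝ)..π, u (X + d * cos θ) (d * sin θ) * sin (2 * θ)| ≤
      2 * ∫ θ in (0:ℝ)..π, u (X + d * cos θ) (d * sin θ) * sin θ := by
    rw [← intervalIntegral.integral_const_mul]
    refine (intervalIntegral.abs_integral_le_integral_abs pi_pos.le).trans ?_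
    apply intervalIntegral.integral_mono_on pi_pos.le
    · exact ((hc0.mul (by fun_prop)).abs).intervalIntegrable _ _
    · exact (continuous_const.mul (hc0.mul (by fun_prop))).intervalIntegrable _ _
    · intro θ hθ
      rw [abs_mul, abs_of_nonneg (hnn θ hθ), sin_two_mul, abs_mul, abs_mul,
        abs_of_nonneg (sin_nonneg_of_mem_Icc hθ)]
      have := abs_cos_le_one θ
      have h3 := mul_nonneg (hnn θ hθ) (sin_nonneg_of_mem_Icc hθ)
      simp only [abs_two]
      nlinarith
  rw [h1, h2, abs_mul, abs_of_pos (by positivity)] at hb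
  have : 0 < π * d := by positivity
  have h4 : (π * d) * (|px (py u) X 0| * d) ≤ (π * d) * (4 * py u X 0) := by nlinarith
  exact le_of_mul_le_mul_left h4 this



/-- Working context. -/
structure Ctx (γ s d k d0 : ℝ) (ψ : ℝ → ℝ → ℝ) (η : ℝ → ℝ) : Prop where
  hγ : 10 ^ 10 < γ
  hs : 0 < s
  hd : 0 < d
  hk : k = γ * d + s
  hd0 : 0 < d0
  e1 : γ * d ^ 2 / 2 + s * d = 1
  e2 : d0 = d + s ^ 2 / 2
  e3 : γ * d0 ^ 2 = 2
  hη : ContDiff ℝ (⊤ : ℕ∞) η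
  hψ : Sm ψ
  dlt : ∀ x, d < η x
  anti : ∀ x y, 0 ≤ x → x ≤ y → η y ≤ η x
  deta : ∀ x, 0 ≤ x → deriv η x ≤ 0
  lap : ∀ x y, 0 ≤ y → y ≤ η x → pxx ψ x y + pyy ψ x y = γ
  bern : ∀ x, (px ψ x (η x)) ^ 2 + (py ψ x (η x)) ^ 2 = k ^ 2 - 2 * (η x - d)
  surf : ∀ x, ψ x (η x) = 1
  bot : ∀ x, ψ x 0 = 0
  evη : ∀ x, η (-x) = η x
  evψ : ∀ x y, ψ (-x) y = ψ x y
  uni : ∀ x y, 0 ≤ y → y ≤ η x → 0 ≤ py ψ x y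
  asym : ∀ ε > 0, ∃ X : ℝ, 0 < X ∧ ∀ x : ℝ, X ≤ |x| → η x - d ≤ ε ∧
      ∀ y, 0 ≤ y → y ≤ η x → |px ψ x y| ≤ ε ∧ |py ψ x y - (γ * y + s)| ≤ ε

theorem mem_of_Ioo {S : Set ℝ} (hS : IsClosed S) {a y : ℝ} (ha : 0 < a)
    (h : ∀ y, 0 < y → y < a → y ∈ S) (h0 : 0 ≤ y) (h1 : y ≤ a) : y ∈ S := by
  have : closure (Ioo 0 a) ⊆ S := closure_minimal (fun y hy => h y hy.1 hy.2) hS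
  rw [closure_Ioo ha.ne] at this
  exact this ⟨h0, h1⟩

theorem Ctx.of {γ sc : ℝ} {ψ : ℝ → ℝ → ℝ} {η : ℝ → ℝ} {r : ℝ} (hγ : 10 ^ 10 < γ)
    (hsc : IsCrit γ sc) (hw : SolitaryWave γ sc ψ η r) (hu : Unidirectional ψ η)
    (hr : r = γ + √(2 / γ)) : ∃ s d k d0, Ctx γ s d k d0 ψ η := by
  obtain ⟨s, hscs, hR, has⟩ := hw.asymptotic
  have hγ0 : 0 < γ := by linarith
  have hs : 0 < s := hsc.1.trans hscs
  set d := lamDepth γ s with hd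
  have hq : √(s ^ 2 + 2 * γ) ^ 2 = s ^ 2 + 2 * γ := sq_sqrt (by positivity)
  have hk : γ * d + s = √(s ^ 2 + 2 * γ) := by
    rw [hd, lamDepth]; field_simp; ring
  have hk2 : (γ * d + s) ^ 2 = s ^ 2 + 2 * γ := by rw [hk, hq]
  have e1 : γ * d ^ 2 / 2 + s * d = 1 := by
    have : γ * (γ * d ^ 2 / 2 + s * d) = γ * 1 := by linear_combination hk2 / 2
    exact mul_left_cancel₀ hγ0.ne' this
  have hdpos : 0 < d := by
    rw [hd, lamDepth]
    apply div_pos _ hγ0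
    have : s < √(s ^ 2 + 2 * γ) := lt_sqrt_of_sq_lt (by linarith)
    linarith
  have e2 : √(2 / γ) = d + s ^ 2 / 2 := by
    unfold bernR at hR; linarith
  have e3 : γ * √(2 / γ) ^ 2 = 2 := by
    rw [sq_sqrt (by positivity)]; field_simp
  have hηs := hw.sol.eta_smooth
  have hψ : Sm ψ := hw.sol.psi_smooth
  have hηc : Continuous η := hηs.continuous
  have anti : ∀ x y, 0 ≤ x → x ≤ y → η y ≤ η x := by
    intro x y hx hxy
    rcases hxy.eq_or_lt with rfl | hlt
    · exact le_rfl
    · have ht : Filter.Tendsto η (nhdsWithin x (Ioi x)) (nhds (η x)) :=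
        hηc.continuousAt.continuousWithinAt
      refine ge_of_tendsto ht ?_
      filter_upwards [Ioo_mem_nhdsGT hlt] with t ht
      exact (hw.eta_anti (mem_Ioi.2 (hx.trans_lt ht.1)) (mem_Ioi.2 (hx.trans_lt hlt)) ht.2).le
  have lb : ∀ x, 0 ≤ x → d ≤ η x := by
    intro x hx
    by_contra hlt
    push Not at hlt
    obtain ⟨X, hX⟩ := has ((d - η x) / 2) (by linarith)
    have h1 := (hX (max x X) (by
      rw [abs_of_nonneg (hx.trans (le_max_left _ _))]; exact le_max_right _ _)).1
    have h2 := anti x (max x X) hx (le_max_left _ _)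
    have := (abs_le.1 h1).1
    linarith
  have dlt0 : ∀ x, 0 ≤ x → d < η x := by
    intro x hx
    have h1 := anti x (x + 1) hx (by linarith)
    have h2 := hw.eta_anti (mem_Ioi.2 (by linarith : 0 < x + 1)) (mem_Ioi.2 (by linarith : 0 < x + 2))
      (by linarith)
    have h3 := lb (x + 2) (by linarith)
    linarith
  refine ⟨s, d, γ * d + s, √(2 / γ), ⟨hγ, hs, hdpos, rfl, sqrt_pos.2 (by positivity), e1, e2, e3, hηs,
    hψ, ?_, anti, ?_, ?_, ?_, hw.sol.surface_val, hw.sol.bottom_val, hw.eta_even, hw.psi_even, ?_, ?_⟩⟩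
  · intro x
    rcases le_total 0 x with h | h
    · exact dlt0 x h
    · rw [← hw.eta_even]; exact dlt0 (-x) (by linarith)
  · intro x hx
    have h1 : AntitoneOn η (Ici 0) := fun a ha b _ hab => anti a b ha hab
    have h2 : derivWithin η (Ici 0) x ≤ 0 := h1.derivWithin_nonpos
    rwa [((hηs.differentiable (by simp) x)).derivWithin (uniqueDiffOn_Ici 0 x hx)] at h2
  · intro x y h0 h1
    have hS : IsClosed {y | pxx ψ x y + pyy ψ x y = γ} := by
      apply isClosed_eq _ continuous_const
      exact (hψ.px.px.contY x).add (hψ.py.py.contY x)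
    exact mem_of_Ioo hS (hw.sol.eta_pos x) (fun y a b => hw.sol.laplace x y a b) h0 h1
  · intro x
    have := hw.sol.bernoulli x
    unfold bernR at hR
    rw [hk2]; linarith
  · intro x y h0 h1
    have hS : IsClosed {y | 0 ≤ py ψ x y} := isClosed_le continuous_const (hψ.py.contY x)
    exact mem_of_Ioo hS (hw.sol.eta_pos x) (fun y a b => (hu x y a b).le) h0 h1
  · intro ε hε
    obtain ⟨X, hX⟩ := has ε hε
    refine ⟨max X 1, lt_max_of_lt_right one_pos, fun x hx => ?_⟩
    obtain ⟨a, b⟩ := hX x ((le_max_left _ _).trans hx)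
    refine ⟨(abs_le.1 a).2, fun y h0 h1 => ?_⟩
    have := b y ⟨h0, h1⟩
    have p1 := abs_nonneg (px ψ x y)
    have p2 := abs_nonneg (py ψ x y - (γ * y + s))
    constructor <;> linarith



/-- The deviation from the laminar flow. -/
def uu (γ s : ℝ) (ψ : ℝ → ℝ → ℝ) (x y : ℝ) : ℝ := (γ * y ^ 2 / 2 + s * y) - ψ x y

theorem right_deriv_nonneg {f : ℝ → ℝ} {f' a : ℝ} (ha : 0 < a) (h0 : f 0 = 0)
    (hf : HasDerivAt f f' 0) (h : ∀ y, 0 ≤ y → y ≤ a → 0 ≤ f y) : 0 ≤ f' := by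
  have h1 : HasDerivWithinAt f f' (Ioi 0) 0 := hf.hasDerivWithinAt
  rw [hasDerivWithinAt_iff_tendsto_slope' (by simp)] at h1
  refine ge_of_tendsto h1 ?_
  filter_upwards [Ioc_mem_nhdsGT ha] with y hy
  rw [slope_def_field, h0]
  have := h y hy.1.le hy.2
  apply div_nonneg <;> linarith [hy.1]

namespace Ctx
variable {γ s d k d0 : ℝ} {ψ : ℝ → ℝ → ℝ} {η : ℝ → ℝ}

theorem γ0 (c : Ctx γ s d k d0 ψ η) : 0 < γ := by have := c.hγ; linarith
theorem k0 (c : Ctx γ s d k d0 ψ η) : 0 < k := by have := c.hk; have := c.γ0; have := c.hs; have := c.hd; rw [c.hk]; positivity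
theorem ηc (c : Ctx γ s d k d0 ψ η) : Continuous η := c.hη.continuous
theorem η0 (c : Ctx γ s d k d0 ψ η) (x : ℝ) : 0 < η x := c.hd.trans (c.dlt x)
theorem ηd (c : Ctx γ s d k d0 ψ η) (x : ℝ) : HasDerivAt η (deriv η x) x := (c.hη.differentiable (by simp) x).hasDerivAt
theorem ηle (c : Ctx γ s d k d0 ψ η) (x : ℝ) : η x ≤ η 0 := by
  rcases le_total 0 x with h | h
  · exact c.anti 0 x le_rfl h
  · rw [← c.evη x]; exact c.anti 0 (-x) le_rfl (by linarith)

theorem smu (c : Ctx γ s d k d0 ψ η) : Sm (uu γ s ψ) :=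
  (Sm.ofY (by fun_prop : ContDiff ℝ (⊤ : ℕ∞) fun y : ℝ => γ * y ^ 2 / 2 + s * y)).sub c.hψ

theorem pxu (c : Ctx γ s d k d0 ψ η) (x y : ℝ) : px (uu γ s ψ) x y = - px ψ x y := by
  have := ((c.hψ.dx x y).const_sub (γ * y ^ 2 / 2 + s * y)).deriv
  exact this

theorem pyu (c : Ctx γ s d k d0 ψ η) (x y : ℝ) : py (uu γ s ψ) x y = γ * y + s - py ψ x y := by
  have h1 : HasDerivAt (fun y : ℝ => γ * y ^ 2 / 2 + s * y) (γ * y + s) y := by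
    refine ((((hasDerivAt_pow 2 y).const_mul γ).div_const 2).add
      ((hasDerivAt_id y).const_mul s)).congr_deriv ?_
    simp; ring
  exact (h1.sub (c.hψ.dy x y)).deriv

theorem pxxu (c : Ctx γ s d k d0 ψ η) (x y : ℝ) : pxx (uu γ s ψ) x y = - pxx ψ x y := by
  have e : px (uu γ s ψ) = fun x y => - px ψ x y := by ext x y; exact c.pxu x y
  unfold pxx
  rw [e]
  exact ((c.hψ.px.dx x y).neg).deriv

theorem pyyu (c : Ctx γ s d k d0 ψ η) (x y : ℝ) : pyy (uu γ s ψ) x y = γ - pyy ψ x y := by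
  have e : py (uu γ s ψ) = fun x y => (γ * y + s) - py ψ x y := by ext x y; exact c.pyu x y
  unfold pyy
  rw [e]
  have h1 : HasDerivAt (fun y : ℝ => γ * y + s) γ y := by
    simpa using ((hasDerivAt_id y).const_mul γ).add_const s
  exact (h1.sub (c.hψ.py.dy x y)).deriv

theorem harm (c : Ctx γ s d k d0 ψ η) (x y : ℝ) (h0 : 0 ≤ y) (h1 : y ≤ η x) :
    pxx (uu γ s ψ) x y + pyy (uu γ s ψ) x y = 0 := by
  rw [c.pxxu, c.pyyu]; have := c.lap x y h0 h1; linarith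

theorem ubot (c : Ctx γ s d k d0 ψ η) (x : ℝ) : uu γ s ψ x 0 = 0 := by simp [uu, c.bot]

theorem usurf (c : Ctx γ s d k d0 ψ η) (x : ℝ) : uu γ s ψ x (η x) = k * (η x - d) + γ * (η x - d) ^ 2 / 2 := by
  have := c.e1
  rw [uu, c.surf, c.hk]; linear_combination this

theorem tang (c : Ctx γ s d k d0 ψ η) (x : ℝ) : px ψ x (η x) = - (deriv η x * py ψ x (η x)) := by
  have h := c.hψ.chain (hasDerivAt_id x) (c.ηd x)
  have h2 : HasDerivAt (fun t => ψ (id t) (η t)) 0 x := by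
    have : (fun t => ψ (id t) (η t)) = fun _ => 1 := by ext t; exact c.surf t
    rw [this]; exact hasDerivAt_const _ _
  have := h.unique h2
  simp only [id] at this
  linarith

theorem pxodd (c : Ctx γ s d k d0 ψ η) (x y : ℝ) : px ψ (-x) y = - px ψ x y := by
  have h1 := (c.hψ.dx x y)
  have h2 : HasDerivAt (fun t => ψ t y) (px ψ (-x) y * (-1)) x := by
    have := (c.hψ.dx (-x) y).comp x ((hasDerivAt_id x).neg)
    refine this.congr_of_eventuallyEq (Filter.Eventually.of_forall fun t => ?_)
    simp [c.evψ]
  have := h1.unique h2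
  linarith

theorem px0 (c : Ctx γ s d k d0 ψ η) (y : ℝ) : px ψ 0 y = 0 := by
  have := c.pxodd 0 y
  simp only [neg_zero] at this; linarith

theorem box (c : Ctx γ s d k d0 ψ η) {H : ℝ → ℝ → ℝ} (hH : Sm H) {a b ε : ℝ}
    (hharm : ∀ x y, 0 < y → y < η x → pxx H x y + pyy H x y = 0)
    (hbot : ∀ x, a ≤ x → x ≤ b → -ε ≤ H x 0)
    (hsurf : ∀ x, a ≤ x → x ≤ b → -ε ≤ H x (η x))
    (ha : ∀ y, 0 ≤ y → y ≤ η a → -ε ≤ H a y) (hb : ∀ y, 0 ≤ y → y ≤ η b → -ε ≤ H b y)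
    (x y : ℝ) (hx : a ≤ x) (hx' : x ≤ b) (h0 : 0 ≤ y) (h1 : y ≤ η x) : -ε ≤ H x y := by
  set K : Set (ℝ × ℝ) := {p | a ≤ p.1 ∧ p.1 ≤ b ∧ 0 ≤ p.2 ∧ p.2 ≤ η p.1} with hKd
  have hηc := c.ηc
  have hKc : IsCompact K := by
    apply (isCompact_Icc (a := a) (b := b)).prod (isCompact_Icc (a := 0) (b := η 0)) |>.of_isClosed_subset
    · refine (isClosed_le continuous_const continuous_fst).inter
        ((isClosed_le continuous_fst continuous_const).inter
        ((isClosed_le continuous_const continuous_snd).inter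
        (isClosed_le continuous_snd (hηc.comp continuous_fst))))
    · rintro p ⟨h1, h2, h3, h4⟩
      exact ⟨⟨h1, h2⟩, ⟨h3, h4.trans (c.ηle _)⟩⟩
  refine min_principle hH hKc ?_ (x, y) ⟨hx, hx', h0, h1⟩
  rintro ⟨x, y⟩ ⟨hx, hx', h0, h1⟩
  simp only at hx hx' h0 h1 ⊢
  rcases h0.eq_or_lt with rfl | h0
  · exact Or.inl (hbot x hx hx')
  rcases h1.eq_or_lt with rfl | h1
  · exact Or.inl (hsurf x hx hx')
  rcases hx.eq_or_lt with rfl | hx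
  · exact Or.inl (ha y h0.le h1.le)
  rcases hx'.eq_or_lt with rfl | hx'
  · exact Or.inl (hb y h0.le h1.le)
  right
  refine ⟨?_, hharm x y h0 h1⟩
  have ho : IsOpen {p : ℝ × ℝ | a < p.1 ∧ p.1 < b ∧ 0 < p.2 ∧ p.2 < η p.1} :=
    (isOpen_lt continuous_const continuous_fst).inter
        ((isOpen_lt continuous_fst continuous_const).inter
        ((isOpen_lt continuous_const continuous_snd).inter
        (isOpen_lt continuous_snd (hηc.comp continuous_fst))))
  filter_upwards [ho.mem_nhds (show (x, y) ∈ _ from ⟨hx, hx', h0, h1⟩)] with p hp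
  exact ⟨hp.1.le, hp.2.1.le, hp.2.2.1.le, hp.2.2.2.le⟩

theorem full (c : Ctx γ s d k d0 ψ η) {H : ℝ → ℝ → ℝ} (hH : Sm H)
    (hharm : ∀ x y, 0 < y → y < η x → pxx H x y + pyy H x y = 0)
    (hbot : ∀ x, 0 ≤ H x 0) (hsurf : ∀ x, 0 ≤ H x (η x))
    (has : ∀ ε > 0, ∃ X, 0 < X ∧ ∀ x, X ≤ |x| → ∀ y, 0 ≤ y → y ≤ η x → -ε ≤ H x y)
    (x y : ℝ) (h0 : 0 ≤ y) (h1 : y ≤ η x) : 0 ≤ H x y := by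
  apply le_of_forall_pos_le_add
  intro ε hε
  obtain ⟨X, hX, h⟩ := has ε hε
  have := c.box hH (a := -(max X |x|)) (b := max X |x|) (ε := ε) hharm
    (fun x _ _ => by linarith [hbot x]) (fun x _ _ => by linarith [hsurf x])
    (h _ (by rw [abs_neg, abs_of_nonneg (hX.le.trans (le_max_left _ _))]; exact le_max_left _ _))
    (h _ (by rw [abs_of_nonneg (hX.le.trans (le_max_left _ _))]; exact le_max_left _ _))
    x y (by have := neg_abs_le x; have := le_max_right X |x|; linarith)
    ((le_abs_self x).trans (le_max_right _ _)) h0 h1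
  linarith

theorem half (c : Ctx γ s d k d0 ψ η) {H : ℝ → ℝ → ℝ} (hH : Sm H)
    (hharm : ∀ x y, 0 < y → y < η x → pxx H x y + pyy H x y = 0)
    (hbot : ∀ x, 0 ≤ x → 0 ≤ H x 0) (hsurf : ∀ x, 0 ≤ x → 0 ≤ H x (η x))
    (hz : ∀ y, 0 ≤ y → y ≤ η 0 → 0 ≤ H 0 y)
    (has : ∀ ε > 0, ∃ X, 0 < X ∧ ∀ x, X ≤ |x| → ∀ y, 0 ≤ y → y ≤ η x → -ε ≤ H x y)
    (x y : ℝ) (hx : 0 ≤ x) (h0 : 0 ≤ y) (h1 : y ≤ η x) : 0 ≤ H x y := by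
  apply le_of_forall_pos_le_add
  intro ε hε
  obtain ⟨X, hX, h⟩ := has ε hε
  have := c.box hH (a := 0) (b := max X x) (ε := ε) hharm
    (fun x h _ => by linarith [hbot x h]) (fun x h _ => by linarith [hsurf x h])
    (fun y h0 h1 => by linarith [hz y h0 h1])
    (h _ (by rw [abs_of_nonneg (hX.le.trans (le_max_left _ _))]; exact le_max_left _ _))
    x y hx (le_max_right _ _) h0 h1
  linarith

theorem harm_px (c : Ctx γ s d k d0 ψ η) (x y : ℝ) (h0 : 0 < y) (h1 : y < η x) :
    pxx (px (uu γ s ψ)) x y + pyy (px (uu γ s ψ)) x y = 0 := by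
  have hu := c.smu
  have e1 : py (px (uu γ s ψ)) = px (py (uu γ s ψ)) := by ext x y; exact (hu.comm x y).symm
  have e2 : pyy (px (uu γ s ψ)) x y = px (py (py (uu γ s ψ))) x y := by
    change py (py (px (uu γ s ψ))) x y = _
    rw [e1, hu.py.comm]
  rw [e2]
  have h : HasDerivAt (fun t => px (px (uu γ s ψ)) t y + py (py (uu γ s ψ)) t y)
    (px (px (px (uu γ s ψ))) x y + px (py (py (uu γ s ψ))) x y) x :=
    (hu.px.px.dx x y).add (hu.py.py.dx x y)
  have hz : (fun t => px (px (uu γ s ψ)) t y + py (py (uu γ s ψ)) t y) =ᶠ[nhds x] fun _ => 0 := by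
    have := c.ηc.continuousAt.eventually (lt_mem_nhds h1)
    filter_upwards [this] with t ht
    exact c.harm t y h0.le ht.le
  exact h.unique ((hasDerivAt_const x (0:ℝ)).congr_of_eventuallyEq hz)

theorem harm_py (c : Ctx γ s d k d0 ψ η) (x y : ℝ) (h0 : 0 < y) (h1 : y < η x) :
    pxx (py (uu γ s ψ)) x y + pyy (py (uu γ s ψ)) x y = 0 := by
  have hu := c.smu
  have e1 : px (py (uu γ s ψ)) = py (px (uu γ s ψ)) := by ext x y; exact (hu.comm x y)
  have e2 : pxx (py (uu γ s ψ)) x y = py (px (px (uu γ s ψ))) x y := by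
    change px (px (py (uu γ s ψ))) x y = _
    rw [e1, hu.px.comm]
  rw [e2]
  have h : HasDerivAt (fun t => px (px (uu γ s ψ)) x t + py (py (uu γ s ψ)) x t)
    (py (px (px (uu γ s ψ))) x y + py (py (py (uu γ s ψ))) x y) y :=
    (hu.px.px.dy x y).add (hu.py.py.dy x y)
  have hz : (fun t => px (px (uu γ s ψ)) x t + py (py (uu γ s ψ)) x t) =ᶠ[nhds y] fun _ => 0 := by
    filter_upwards [lt_mem_nhds h0, gt_mem_nhds h1] with t ht ht'
    exact c.harm x t (le_of_lt ht) (le_of_lt ht')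
  exact h.unique ((hasDerivAt_const y (0:ℝ)).congr_of_eventuallyEq hz)

theorem small_u (c : Ctx γ s d k d0 ψ η) {x y ε : ℝ} (h0 : 0 ≤ y)
    (h : ∀ t, 0 ≤ t → t ≤ y → |py (uu γ s ψ) x t| ≤ ε) : |uu γ s ψ x y| ≤ ε * y := by
  have := (convex_Icc 0 y).norm_image_sub_le_of_norm_hasDerivWithin_le (f := uu γ s ψ x)
    (f' := py (uu γ s ψ) x) (C := ε)
    (fun t _ => (c.smu.dy x t).hasDerivWithinAt) (fun t ht => h t ht.1 ht.2)
    (left_mem_Icc.2 h0) (right_mem_Icc.2 h0)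
  simpa [c.ubot, abs_of_nonneg h0] using this

theorem asymu (c : Ctx γ s d k d0 ψ η) : ∀ ε > 0, ∃ X, 0 < X ∧ ∀ x, X ≤ |x| → η x - d ≤ ε ∧ ∀ y, 0 ≤ y → y ≤ η x →
    |uu γ s ψ x y| ≤ ε ∧ |px (uu γ s ψ) x y| ≤ ε ∧ |py (uu γ s ψ) x y| ≤ ε := by
  intro ε hε
  have hη0 := c.η0 0
  obtain ⟨X, hX, h⟩ := c.asym (min ε (ε / η 0)) (by apply lt_min hε; positivity)
  refine ⟨X, hX, fun x hx => ⟨(h x hx).1.trans (min_le_left _ _), fun y h0 h1 => ?_⟩⟩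
  have key : ∀ y, 0 ≤ y → y ≤ η x → |py (uu γ s ψ) x y| ≤ min ε (ε / η 0) := by
    intro y h0 h1
    rw [c.pyu, abs_sub_comm]
    exact ((h x hx).2 y h0 h1).2
  refine ⟨?_, ?_, (key y h0 h1).trans (min_le_left _ _)⟩
  · have := c.small_u h0 (fun t a b => (key t a (b.trans h1)).trans (min_le_right _ _))
    refine this.trans ?_
    rw [div_mul_eq_mul_div, div_le_iff₀ hη0]
    exact mul_le_mul_of_nonneg_left (h1.trans (c.ηle x)) hε.le
  · rw [c.pxu, abs_neg]
    exact (((h x hx).2 y h0 h1).1).trans (min_le_left _ _)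

theorem u_nonneg (c : Ctx γ s d k d0 ψ η) (x y : ℝ) (h0 : 0 ≤ y) (h1 : y ≤ η x) : 0 ≤ uu γ s ψ x y := by
  refine c.full c.smu (fun x y a b => c.harm x y a.le b.le) (fun x => (c.ubot x).ge) ?_ ?_ x y h0 h1
  · intro x
    rw [c.usurf]
    have := c.dlt x; have := c.k0; have := c.γ0
    have : 0 ≤ η x - d := by linarith
    positivity
  · intro ε hε
    obtain ⟨X, hX, h⟩ := c.asymu ε hε
    exact ⟨X, hX, fun x hx y a b => (abs_le.1 ((h x hx).2 y a b).1).1⟩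

theorem psiy_le_k (c : Ctx γ s d k d0 ψ η) (x : ℝ) : py ψ x (η x) ≤ k := by
  have := c.bern x; have := c.dlt x; have := c.k0
  nlinarith [sq_nonneg (px ψ x (η x))]

theorem uy_nonneg (c : Ctx γ s d k d0 ψ η) (x y : ℝ) (h0 : 0 ≤ y) (h1 : y ≤ η x) : 0 ≤ py (uu γ s ψ) x y := by
  refine c.full c.smu.py c.harm_py ?_ ?_ ?_ x y h0 h1
  · intro x
    exact right_deriv_nonneg (c.η0 x) (c.ubot x) (c.smu.dy x 0) (c.u_nonneg x)
  · intro x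
    rw [c.pyu]
    have := c.psiy_le_k x; have := c.dlt x; have := c.γ0; have := c.hk
    nlinarith
  · intro ε hε
    obtain ⟨X, hX, h⟩ := c.asymu ε hε
    exact ⟨X, hX, fun x hx y a b => (abs_le.1 ((h x hx).2 y a b).2.2).1⟩

theorem psix_le_k (c : Ctx γ s d k d0 ψ η) (x y : ℝ) (h0 : 0 ≤ y) (h1 : y ≤ η x) : px ψ x y ≤ k := by
  have hk0 := c.k0
  have hconst : ∀ x y, pxx (fun x y => px (uu γ s ψ) x y + k) x y = pxx (px (uu γ s ψ)) x y ∧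
      pyy (fun x y => px (uu γ s ψ) x y + k) x y = pyy (px (uu γ s ψ)) x y := by
    intro x y
    simp only [pxx, pyy, px, py, deriv_add_const]
    exact ⟨trivial, trivial⟩
  have h2 := c.full (H := fun x y => px (uu γ s ψ) x y + k)
    (c.smu.px.add (Sm.ofY contDiff_const)) (by
      intro x y a b
      rw [(hconst x y).1, (hconst x y).2]
      exact c.harm_px x y a b) ?_ ?_ ?_ x y h0 h1
  · rw [c.pxu] at h2; linarith
  · intro x
    rw [px_bot c.ubot]; linarith
  · intro x
    rw [c.pxu]
    have := c.bern x; have := c.dlt x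
    nlinarith [sq_nonneg (py ψ x (η x))]
  · intro ε hε
    obtain ⟨X, hX, h⟩ := c.asymu ε hε
    exact ⟨X, hX, fun x hx y a b => by linarith [(abs_le.1 ((h x hx).2 y a b).2.1).1]⟩

theorem psix_nonneg (c : Ctx γ s d k d0 ψ η) (x y : ℝ) (hx : 0 ≤ x) (h0 : 0 ≤ y) (h1 : y ≤ η x) : 0 ≤ px ψ x y := by
  have hneg : ∀ x y, pxx (fun x y => - px (uu γ s ψ) x y) x y = - pxx (px (uu γ s ψ)) x y ∧
      pyy (fun x y => - px (uu γ s ψ) x y) x y = - pyy (px (uu γ s ψ)) x y := by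
    intro x y
    simp only [pxx, pyy, px, py, deriv.fun_neg]
    exact ⟨trivial, trivial⟩
  have h2 := c.half (H := fun x y => - px (uu γ s ψ) x y)
    c.smu.px.neg (by
      intro x y a b
      rw [(hneg x y).1, (hneg x y).2]
      have := c.harm_px x y a b; linarith) ?_ ?_ ?_ ?_ x y hx h0 h1
  · simpa [c.pxu] using h2
  · intro x _
    rw [px_bot c.ubot]; simp
  · intro x hx
    rw [c.pxu, neg_neg, c.tang]
    have h1 := c.uni x (η x) (c.η0 x).le le_rfl
    have h2 := c.deta x hx
    nlinarith
  · intro y _ _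
    rw [c.pxu, c.px0]; simp
  · intro ε hε
    obtain ⟨X, hX, h⟩ := c.asymu ε hε
    exact ⟨X, hX, fun x hx y a b => by linarith [(abs_le.1 ((h x hx).2 y a b).2.1).2]⟩

theorem u_anti (c : Ctx γ s d k d0 ψ η) (x1 x2 y : ℝ) (h : 0 ≤ x1) (h12 : x1 ≤ x2) (h0 : 0 ≤ y) (h1 : y ≤ η x2) :
    uu γ s ψ x2 y ≤ uu γ s ψ x1 y := by
  have : AntitoneOn (fun x => uu γ s ψ x y) (Icc x1 x2) := by
    apply antitoneOn_of_deriv_nonpos (convex_Icc _ _)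
    · exact fun x _ => (c.smu.dx x y).continuousAt.continuousWithinAt
    · exact fun x _ => (c.smu.dx x y).differentiableAt.differentiableWithinAt
    · intro x hx
      rw [interior_Icc] at hx
      rw [(c.smu.dx x y).deriv, c.pxu]
      have := c.psix_nonneg x y (h.trans hx.1.le) h0
        (h1.trans (c.anti x x2 (h.trans hx.1.le) hx.2.le))
      linarith
  exact this (left_mem_Icc.2 h12) (right_mem_Icc.2 h12) h12

theorem β_anti (c : Ctx γ s d k d0 ψ η) (x1 x2 : ℝ) (h : 0 ≤ x1) (h12 : x1 ≤ x2) :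
    py (uu γ s ψ) x2 0 ≤ py (uu γ s ψ) x1 0 := by
  have := right_deriv_nonneg (f := fun y => uu γ s ψ x1 y - uu γ s ψ x2 y) (c.η0 x2)
    (by simp [c.ubot]) ((c.smu.dy x1 0).sub (c.smu.dy x2 0))
    (fun y a b => by have := c.u_anti x1 x2 y h h12 a b; linarith)
  linarith

theorem β_nonneg (c : Ctx γ s d k d0 ψ η) (x : ℝ) : 0 ≤ py (uu γ s ψ) x 0 := c.uy_nonneg x 0 le_rfl (c.η0 x).le

theorem β_le (c : Ctx γ s d k d0 ψ η) (x : ℝ) : py (uu γ s ψ) x 0 ≤ s := by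
  rw [c.pyu]; have := c.uni x 0 le_rfl (c.η0 x).le; linarith

theorem β_harnack (c : Ctx γ s d k d0 ψ η) (x : ℝ) : |px (py (uu γ s ψ)) x 0| * d ≤ 4 * py (uu γ s ψ) x 0 := by
  have hy : ∀ x y X : ℝ, 0 ≤ y → (x - X) ^ 2 + y ^ 2 ≤ d ^ 2 → y ≤ η x := by
    intro x y X h0 h1
    have : y ≤ d := by have := c.hd; nlinarith [sq_nonneg (x - X)]
    exact this.trans (c.dlt x).le
  exact HalfDisc.harnack ⟨c.smu, c.ubot, fun a b h0 h1 => c.harm a b h0 (hy a b x h0 h1)⟩ c.hd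
    (fun a b h0 h1 => c.u_nonneg a b h0 (hy a b x h0 h1))

end Ctx



theorem abs_int_le {F : ℝ → ℝ} {a C : ℝ} (ha : 0 ≤ a) (h : ∀ y, 0 ≤ y → y ≤ a → |F y| ≤ C) :
    |∫ y in (0:ℝ)..a, F y| ≤ C * a := by
  have := intervalIntegral.norm_integral_le_of_norm_le_const (f := F) (a := 0) (b := a) (C := C)
    (fun y hy => by
      rw [uIoc_of_le ha] at hy
      exact h y hy.1.le hy.2)
  simpa [abs_of_nonneg ha] using this

def EE (γ s d : ℝ) (ψ : ℝ → ℝ → ℝ) (η : ℝ → ℝ) (x : ℝ) : ℝ :=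
  ∫ y in (0:ℝ)..η x, (d - y) * px (uu γ s ψ) x y

def NN (ψ : ℝ → ℝ → ℝ) (η : ℝ → ℝ) (x : ℝ) : ℝ :=
  ∫ y in (0:ℝ)..η x, px ψ x y * py ψ x y

def MM (γ s : ℝ) (ψ : ℝ → ℝ → ℝ) (η : ℝ → ℝ) (x : ℝ) : ℝ :=
  ∫ y in (0:ℝ)..η x, (py (uu γ s ψ) x y * py (uu γ s ψ) x y - px (uu γ s ψ) x y * px (uu γ s ψ) x y)

def TT (ψ : ℝ → ℝ → ℝ) (η : ℝ → ℝ) (x : ℝ) : ℝ := py ψ x (η x) * (1 + deriv η x ^ 2)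

namespace Ctx
variable {γ s d k d0 : ℝ} {ψ : ℝ → ℝ → ℝ} {η : ℝ → ℝ}

theorem k2 (c : Ctx γ s d k d0 ψ η) : k ^ 2 = s ^ 2 + 2 * γ := by rw [c.hk]; linear_combination 2 * γ * c.e1

theorem T_nonneg (c : Ctx γ s d k d0 ψ η) (x : ℝ) : 0 ≤ TT ψ η x :=
  mul_nonneg (c.uni x (η x) (c.η0 x).le le_rfl) (by positivity)

theorem T_sq (c : Ctx γ s d k d0 ψ η) (x : ℝ) : k ^ 2 - 2 * (η x - d) ≤ TT ψ η x ^ 2 := by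
  have h1 := c.bern x
  rw [c.tang] at h1
  rw [← h1, TT]
  have : 0 ≤ (py ψ x (η x) ^ 2 * (1 + deriv η x ^ 2)) * deriv η x ^ 2 := by positivity
  nlinarith

theorem E_deriv (c : Ctx γ s d k d0 ψ η) (x : ℝ) : HasDerivAt (EE γ s d ψ η)
    (d * py (uu γ s ψ) x 0 - (η x - d) * (TT ψ η x - γ * (η x - d) / 2)) x := by
  have hu := c.smu
  have hdy : Sm (fun _ y => d - y) := Sm.ofY (by fun_prop : ContDiff ℝ (⊤ : ℕ∞) fun y : ℝ => d - y)
  have h := flux (F := fun x y => (d - y) * px (uu γ s ψ) x y)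
    (G := fun x y => (d - y) * py (uu γ s ψ) x y + uu γ s ψ x y) (hdy.mul hu.px)
    ((hdy.mul hu.py).add hu) c.hη (fun x => (c.η0 x).le) (by
      intro x y h0 h1
      have hF : px (fun x y => (d - y) * px (uu γ s ψ) x y) x y = (d - y) * pxx (uu γ s ψ) x y :=
        ((hu.px.dx x y).const_mul (d - y)).deriv
      have hdy1 : HasDerivAt (fun y => d - y) (-1) y := (hasDerivAt_id y).const_sub d
      have hG : py (fun x y => (d - y) * py (uu γ s ψ) x y + uu γ s ψ x y) x y =
          (-1) * py (uu γ s ψ) x y + (d - y) * pyy (uu γ s ψ) x y + py (uu γ s ψ) x y :=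
        ((hdy1.mul (hu.py.dy x y)).add (hu.dy x y)).deriv
      rw [hF, hG]
      have := c.harm x y h0 h1
      linear_combination (d - y) * this) x
  refine h.congr_deriv ?_
  simp only [c.ubot, c.usurf, TT]
  have e1 := c.pyu x (η x)
  have e2 := c.pxu x (η x)
  rw [c.tang] at e2
  rw [e1, e2, c.hk]
  ring

theorem N_deriv (c : Ctx γ s d k d0 ψ η) (x : ℝ) : HasDerivAt (NN ψ η)
    ((η x - d) - s * py (uu γ s ψ) x 0 + py (uu γ s ψ) x 0 ^ 2 / 2) x := by
  have hu := c.hψ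
  have h := flux (F := fun x y => px ψ x y * py ψ x y)
    (G := fun x y => ((1/2) * (py ψ x y * py ψ x y - px ψ x y * px ψ x y)) - γ * ψ x y)
    (hu.px.mul hu.py)
    (((Sm.ofY contDiff_const).mul ((hu.py.mul hu.py).sub (hu.px.mul hu.px))).sub
      ((Sm.ofY contDiff_const).mul hu)) c.hη (fun x => (c.η0 x).le) (by
      intro x y h0 h1
      have hF : px (fun x y => px ψ x y * py ψ x y) x y =
          px (px ψ) x y * py ψ x y + px ψ x y * px (py ψ) x y :=
        ((hu.px.dx x y).mul (hu.py.dx x y)).deriv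
      have hG : py (fun x y => ((1/2) * (py ψ x y * py ψ x y - px ψ x y * px ψ x y)) - γ * ψ x y) x y =
          (1/2) * ((py (py ψ) x y * py ψ x y + py ψ x y * py (py ψ) x y) -
            (py (px ψ) x y * px ψ x y + px ψ x y * py (px ψ) x y)) - γ * py ψ x y :=
        (((((hu.py.dy x y).mul (hu.py.dy x y)).sub
          ((hu.px.dy x y).mul (hu.px.dy x y))).const_mul (1/2)).sub ((hu.dy x y).const_mul γ)).deriv
      rw [hF, hG, hu.comm]
      have : px (px ψ) x y + py (py ψ) x y = γ := c.lap x y h0 h1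
      linear_combination (py ψ x y) * this) x
  refine h.congr_deriv ?_
  simp only [c.bot, c.surf, px_bot c.bot]
  have e1 := c.pyu x 0
  have e2 := c.bern x
  have e3 := c.k2
  rw [c.tang] at e2 ⊢
  rw [e1]
  linear_combination (-1/2) * e2 - (1/2) * e3

theorem M_deriv (c : Ctx γ s d k d0 ψ η) (x : ℝ) : HasDerivAt (MM γ s ψ η)
    (2 * (deriv η x * ((η x - d) + k * γ * (η x - d) + γ ^ 2 * (η x - d) ^ 2 / 2))) x := by
  have hu := c.smu
  have h := flux (F := fun x y => py (uu γ s ψ) x y * py (uu γ s ψ) x y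
      - px (uu γ s ψ) x y * px (uu γ s ψ) x y)
    (G := fun x y => (-2) * (px (uu γ s ψ) x y * py (uu γ s ψ) x y))
    ((hu.py.mul hu.py).sub (hu.px.mul hu.px))
    ((Sm.ofY contDiff_const).mul (hu.px.mul hu.py)) c.hη (fun x => (c.η0 x).le) (by
      intro x y h0 h1
      have hF : px (fun x y => py (uu γ s ψ) x y * py (uu γ s ψ) x y
          - px (uu γ s ψ) x y * px (uu γ s ψ) x y) x y =
          (px (py (uu γ s ψ)) x y * py (uu γ s ψ) x y + py (uu γ s ψ) x y * px (py (uu γ s ψ)) x y)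
          - (px (px (uu γ s ψ)) x y * px (uu γ s ψ) x y
            + px (uu γ s ψ) x y * px (px (uu γ s ψ)) x y) :=
        (((hu.py.dx x y).mul (hu.py.dx x y)).sub ((hu.px.dx x y).mul (hu.px.dx x y))).deriv
      have hG : py (fun x y => (-2) * (px (uu γ s ψ) x y * py (uu γ s ψ) x y)) x y =
          (-2) * (py (px (uu γ s ψ)) x y * py (uu γ s ψ) x y
            + px (uu γ s ψ) x y * py (py (uu γ s ψ)) x y) :=
        (((hu.px.dy x y).mul (hu.py.dy x y)).const_mul (-2)).deriv
      rw [hF, hG, hu.comm]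
      have : px (px (uu γ s ψ)) x y + py (py (uu γ s ψ)) x y = 0 := c.harm x y h0 h1
      linear_combination (-2 * px (uu γ s ψ) x y) * this) x
  refine h.congr_deriv ?_
  simp only [px_bot c.ubot]
  have e1 := c.pyu x (η x)
  have e2 := c.pxu x (η x)
  have e3 := c.bern x
  rw [c.tang] at e2 e3
  rw [e1, e2]
  have hk := c.hk
  have hs : s = k - γ * d := by linarith
  rw [hs]
  linear_combination (-deriv η x) * e3

theorem E_zero (c : Ctx γ s d k d0 ψ η) : EE γ s d ψ η 0 = 0 := by
  simp [EE, c.pxu, c.px0]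

theorem N_zero (c : Ctx γ s d k d0 ψ η) : NN ψ η 0 = 0 := by
  simp [NN, c.px0]

/-- decay of all flux quantities -/
theorem flux_lim (c : Ctx γ s d k d0 ψ η) : ∀ ε > 0, ∃ X, 0 < X ∧ ∀ x, X ≤ x →
    |EE γ s d ψ η x| ≤ ε ∧ |NN ψ η x| ≤ ε ∧ |MM γ s ψ η x| ≤ ε ∧ η x - d ≤ ε := by
  intro ε hε
  have hη0 := c.η0 0
  have hd := c.hd
  have hγ := c.γ0
  have hs := c.hs
  set A := d + η 0 + (γ * η 0 + s + 1) + 2 with hA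
  have hA0 : 0 < A := by positivity
  obtain ⟨X, hX, h⟩ := c.asymu (min 1 (min ε (ε / (A * η 0)))) (by
    apply lt_min one_pos; apply lt_min hε; positivity)
  set δ := min 1 (min ε (ε / (A * η 0))) with hδ
  have d1 : δ ≤ 1 := min_le_left _ _
  have d2 : δ ≤ ε := (min_le_right _ _).trans (min_le_left _ _)
  have d3 : δ ≤ ε / (A * η 0) := (min_le_right _ _).trans (min_le_right _ _)
  have d0 : 0 < δ := by apply lt_min one_pos; apply lt_min hε; positivity
  have d4 : δ * A * η 0 ≤ ε := by
    rw [le_div_iff₀ (by positivity)] at d3; linarith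
  refine ⟨X, hX, fun x hx => ?_⟩
  have hx' : X ≤ |x| := hx.trans (le_abs_self x)
  obtain ⟨h1, h2⟩ := h x hx'
  have hle := c.ηle x
  have hx0 := c.η0 x
  have fin : ∀ F : ℝ → ℝ, (∀ y, 0 ≤ y → y ≤ η x → |F y| ≤ δ * A) → |∫ y in (0:ℝ)..η x, F y| ≤ ε := by
    intro F hF
    refine (abs_int_le hx0.le hF).trans (le_trans ?_ d4)
    exact mul_le_mul_of_nonneg_left hle (by positivity)
  refine ⟨fin _ ?_, fin _ ?_, fin _ ?_, h1.trans d2⟩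
  · intro y a b
    rw [abs_mul, mul_comm δ A]
    have e1 : |d - y| ≤ A := by
      have : 0 < γ * η 0 := by positivity
      rw [abs_le]; constructor <;> linarith
    exact mul_le_mul e1 (h2 y a b).2.1 (abs_nonneg _) hA0.le
  · intro y a b
    obtain ⟨_, p1, p2⟩ := h2 y a b
    rw [c.pxu, abs_neg] at p1
    rw [c.pyu] at p2
    rw [abs_mul]
    refine mul_le_mul p1 ?_ (abs_nonneg _) d0.le
    have : γ * y ≤ γ * η 0 := mul_le_mul_of_nonneg_left (b.trans hle) hγ.le
    have : 0 ≤ γ * y := by positivity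
    have := abs_le.1 p2
    rw [abs_le]; constructor <;> linarith
  · intro y a b
    obtain ⟨_, p1, p2⟩ := h2 y a b
    rw [← pow_two, ← pow_two]
    have q1 := abs_le.1 p1
    have q2 := abs_le.1 p2
    have r1 : px (uu γ s ψ) x y ^ 2 ≤ δ := by
      have : px (uu γ s ψ) x y ^ 2 ≤ δ ^ 2 := sq_le_sq' q1.1 q1.2
      nlinarith
    have r2 : py (uu γ s ψ) x y ^ 2 ≤ δ := by
      have : py (uu γ s ψ) x y ^ 2 ≤ δ ^ 2 := sq_le_sq' q2.1 q2.2
      nlinarith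
    have r3 : δ ≤ δ * A := by
      have : 1 ≤ A := by have : 0 < γ * η 0 := by positivity
                         linarith
      nlinarith
    have := sq_nonneg (px (uu γ s ψ) x y)
    have := sq_nonneg (py (uu γ s ψ) x y)
    rw [abs_le]; constructor <;> linarith

theorem M_eq (c : Ctx γ s d k d0 ψ η) (x : ℝ) : MM γ s ψ η x = (η x - d) ^ 2 + k * γ * (η x - d) ^ 2
    + γ ^ 2 * (η x - d) ^ 3 / 3 := by
  set g : ℝ → ℝ := fun x => MM γ s ψ η x - ((1 + k * γ) * (η x - d) ^ 2
    + γ ^ 2 / 3 * (η x - d) ^ 3) with hg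
  have hgd : ∀ x, HasDerivAt g 0 x := by
    intro x
    have hz : HasDerivAt (fun x => η x - d) (deriv η x) x := (c.ηd x).sub_const d
    refine ((c.M_deriv x).sub (((hz.pow 2).const_mul (1 + k * γ)).add
      ((hz.pow 3).const_mul (γ ^ 2 / 3)))).congr_deriv ?_
    simp; ring
  have hconst : ∀ y, g x = g y := fun y =>
    is_const_of_deriv_eq_zero (fun x => (hgd x).differentiableAt) (fun x => (hgd x).deriv) x y
  have hk := c.k0
  have hγ := c.γ0
  have hgx : g x = 0 := by
    by_contra hne
    have hpos : 0 < |g x| := abs_pos.2 hne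
    set B := 1 + ((1 + k * γ) + γ ^ 2 / 3) with hB
    have hB0 : 0 < B := by positivity
    obtain ⟨X, hX, h⟩ := c.flux_lim (min 1 (|g x| / (2 * B))) (by apply lt_min one_pos; positivity)
    obtain ⟨_, _, h1, h2⟩ := h X le_rfl
    set δ := min 1 (|g x| / (2 * B)) with hδ
    have d1 : δ ≤ 1 := min_le_left _ _
    have d3 : δ ≤ |g x| / (2 * B) := min_le_right _ _
    have h3 : 0 < η X - d := by linarith [c.dlt X]
    have h4 : |g X| ≤ B * δ := by
      have z2 : (η X - d) ^ 2 ≤ δ := by nlinarith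
      have z3 : (η X - d) ^ 3 ≤ δ := by
        have : (η X - d) ^ 3 = (η X - d) * (η X - d) ^ 2 := by ring
        have := sq_nonneg (η X - d)
        nlinarith
      have z4 := mul_le_mul_of_nonneg_left z2 (by positivity : 0 ≤ 1 + k * γ)
      have z5 := mul_le_mul_of_nonneg_left z3 (by positivity : 0 ≤ γ ^ 2 / 3)
      have z6 : 0 ≤ (1 + k * γ) * (η X - d) ^ 2 := by positivity
      have z7 : 0 ≤ γ ^ 2 / 3 * (η X - d) ^ 3 := by positivity
      have := abs_le.1 h1
      have eB : B * δ = δ + ((1 + k * γ) * δ + γ ^ 2 / 3 * δ) := by rw [hB]; ring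
      rw [eB, hg, abs_le]
      constructor
      · simp only; linarith
      · have : 0 ≤ (1 + k * γ) * δ := z6.trans z4
        have : 0 ≤ γ ^ 2 / 3 * δ := z7.trans z5
        simp only; linarith
    rw [← hconst X] at h4
    have : B * δ ≤ |g x| / 2 := by
      have := mul_le_mul_of_nonneg_left d3 hB0.le
      have e : B * (|g x| / (2 * B)) = |g x| / 2 := by field_simp
      linarith
    linarith
  rw [hg] at hgx
  simp only at hgx
  linear_combination hgx

end Ctx



theorem le_of_sq_le_sq2 {a b : ℝ} (h : a ^ 2 ≤ b ^ 2) (hb : 0 ≤ b) : a ≤ b := by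
  by_contra hlt
  push Not at hlt
  nlinarith

namespace Ctx
variable {γ s d k d0 : ℝ} {ψ : ℝ → ℝ → ℝ} {η : ℝ → ℝ}

theorem d_le (c : Ctx γ s d k d0 ψ η) : d < d0 := by have := c.e2; have := c.hs; nlinarith [sq_nonneg s]

theorem e4 (c : Ctx γ s d k d0 ψ η) : s * γ * (d0 + d) = 4 * d := by
  have h : s * (s * γ * (d0 + d)) = s * (4 * d) := by
    have h1 := c.e1; have h2 := c.e2; have h3 := c.e3
    have h4 : s ^ 2 = 2 * (d0 - d) := by linarith
    linear_combination γ * (d0 + d) * h4 + 2 * h3 - 4 * h1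
  exact mul_left_cancel₀ c.hs.ne' h

theorem sγ (c : Ctx γ s d k d0 ψ η) : s * γ ≤ 2 := by
  have h := c.e4
  have h1 := c.d_le; have hd := c.hd
  have hp : 0 < s * γ := mul_pos c.hs c.γ0
  have : (s * γ) * (2 * d) ≤ 2 * (2 * d) := by nlinarith
  exact le_of_mul_le_mul_right this (by linarith)

theorem s_small (c : Ctx γ s d k d0 ψ η) : s ≤ 1 / 10 ^ 9 := by
  have h := c.sγ; have := c.hγ; have hs := c.hs
  by_contra hlt
  push Not at hlt
  nlinarith

theorem d0_small (c : Ctx γ s d k d0 ψ η) : d0 ≤ 1 := by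
  have h := c.e3; have := c.hγ; have := c.hd0
  by_contra hlt
  push Not at hlt
  nlinarith

theorem d0_le (c : Ctx γ s d k d0 ψ η) : d0 ≤ 2 * d := by
  have h1 := c.e1; have h3 := c.e3; have hs := c.s_small; have h0 := c.hs
  have hd := c.hd; have hd0 := c.d0_small; have hdd := c.d_le; have hγ := c.γ0
  by_contra hlt
  push Not at hlt
  have h4 : s * d ≤ 1 / 4 := by nlinarith
  have h5 : γ * d ^ 2 ≥ 3 / 2 := by linarith
  have h6 : (2 * d) ^ 2 < d0 ^ 2 := by nlinarith
  nlinarith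

theorem kd_le (c : Ctx γ s d k d0 ψ η) : k * d ≤ 2 := by
  have h1 := c.e1; have := mul_pos c.hs c.hd
  rw [c.hk]; nlinarith

theorem kd_ge (c : Ctx γ s d k d0 ψ η) : 1 ≤ k * d := by
  have h1 := c.e1; have := mul_pos c.hs c.hd
  rw [c.hk]; nlinarith [c.s_small, c.d_le, c.d0_small, c.hs, c.hd]

theorem uy_le (c : Ctx γ s d k d0 ψ η) (x y : ℝ) (h0 : 0 ≤ y) (h1 : y ≤ d) : py (uu γ s ψ) x y ≤ k := by
  rw [c.pyu, c.hk]
  have := c.uni x y h0 (h1.trans (c.dlt x).le)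
  have := mul_le_mul_of_nonneg_left h1 c.γ0.le
  linarith

theorem u0_sq (c : Ctx γ s d k d0 ψ η) : uu γ s ψ 0 d ^ 2 ≤ 64 * (d * s) := by
  have hd := c.hd
  set u0 := uu γ s ψ 0 d with hu0
  have hu0n : 0 ≤ u0 := c.u_nonneg 0 d hd.le (c.dlt 0).le
  have hψ0 : 0 ≤ ψ 0 d := by
    have hm : MonotoneOn (ψ 0) (Icc 0 d) := by
      apply monotoneOn_of_deriv_nonneg (convex_Icc _ _)
      · exact fun y _ => (c.hψ.dy 0 y).continuousAt.continuousWithinAt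
      · exact fun y _ => (c.hψ.dy 0 y).differentiableAt.differentiableWithinAt
      · intro y hy
        rw [interior_Icc] at hy
        rw [(c.hψ.dy 0 y).deriv]
        exact c.uni 0 y hy.1.le (hy.2.le.trans (c.dlt 0).le)
    have := hm (left_mem_Icc.2 hd.le) (right_mem_Icc.2 hd.le) hd.le
    rwa [c.bot] at this
  have hu01 : u0 ≤ 1 := by
    rw [hu0, uu]; have := c.e1; linarith
  have hη : ∀ x y : ℝ, 0 ≤ y → (x - 0) ^ 2 + y ^ 2 ≤ d ^ 2 → y ≤ η x := by
    intro x y h0 h1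
    have : y ≤ d := by nlinarith [sq_nonneg (x - 0)]
    exact this.trans (c.dlt x).le
  have hH := HalfDisc.H1 (u := uu γ s ψ) (X := 0) (d := d)
    ⟨c.smu, c.ubot, fun a b h0 h1 => c.harm a b h0 (hη a b h0 h1)⟩ hd
  set U : ℝ → ℝ := fun θ => uu γ s ψ (0 + d * cos θ) (d * sin θ) with hU
  have hUc : Continuous U := c.smu.polt 0 d
  have hdsin : ∀ θ, d * sin θ ≤ d := fun θ => mul_le_of_le_one_right hd.le (sin_le_one θ)
  have hUn : ∀ θ ∈ Icc 0 π, 0 ≤ U θ := fun θ hθ =>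
    c.u_nonneg _ _ (mul_nonneg hd.le (sin_nonneg_of_mem_Icc hθ)) ((hdsin θ).trans (c.dlt _).le)
  have hπ := pi_gt_three
  have hπ4 := pi_le_four
  have hUl : ∀ θ, 0 ≤ θ → θ ≤ π / 2 → u0 - 4 * (π / 2 - θ) ≤ U θ := by
    intro θ h0 h1
    have := (convex_Icc 0 (π / 2)).image_sub_le_mul_sub_of_deriv_le (f := U) (C := 4)
      hUc.continuousOn (fun t _ => (c.smu.pol_t 0 d t).differentiableAt.differentiableWithinAt)
      (by
        intro t ht
        rw [interior_Icc] at ht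
        rw [hU, (c.smu.pol_t 0 d t).deriv]
        have hs0 : 0 ≤ sin t := sin_nonneg_of_mem_Icc ⟨ht.1.le, by linarith [ht.2]⟩
        have hc0 : 0 ≤ cos t := cos_nonneg_of_mem_Icc ⟨by linarith [ht.1], ht.2.le⟩
        have hs1 := sin_le_one t
        have hc1 := cos_le_one t
        have hy0 : 0 ≤ d * sin t := mul_nonneg hd.le hs0
        have hyη := (hdsin t).trans (c.dlt (0 + d * cos t)).le
        have a1 := c.uy_le (0 + d * cos t) _ hy0 (hdsin t)
        have a2 := c.psix_le_k (0 + d * cos t) _ hy0 hyη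
        rw [c.pxu]
        have hk := c.k0
        have b1 : py (uu γ s ψ) (0 + d * cos t) (d * sin t) * cos t ≤ k := by nlinarith
        have b2 : px ψ (0 + d * cos t) (d * sin t) * sin t ≤ k := by nlinarith
        have := c.kd_le
        nlinarith)
      θ ⟨h0, h1⟩ (π / 2) ⟨by linarith, le_rfl⟩ h1
    have e : U (π / 2) = u0 := by simp [hU, hu0]
    linarith
  have hcint : Continuous (fun θ => U θ * sin θ) := hUc.mul continuous_sin
  have hsub : ∫ θ in (π / 2 - u0 / 8)..(π / 2), U θ * sin θ ≤ ∫ θ in (0:ℝ)..π, U θ * sin θ := by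
    apply intervalIntegral.integral_mono_interval (by linarith) (by linarith) (by linarith)
    · filter_upwards [MeasureTheory.ae_restrict_mem measurableSet_Ioc] with θ hθ
      exact mul_nonneg (hUn θ ⟨hθ.1.le, hθ.2⟩) (sin_nonneg_of_mem_Icc ⟨hθ.1.le, hθ.2⟩)
    · exact hcint.intervalIntegrable _ _
  have hlow : ∫ θ in (π / 2 - u0 / 8)..(π / 2), u0 / 4 ≤
      ∫ θ in (π / 2 - u0 / 8)..(π / 2), U θ * sin θ := by
    apply intervalIntegral.integral_mono_on (by linarith) (by simp) (hcint.intervalIntegrable _ _)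
    intro θ hθ
    have h0 : 0 ≤ θ := by linarith [hθ.1]
    have a1 := hUl θ h0 hθ.2
    have a2 : 1 / 2 ≤ sin θ := by
      have := mul_le_sin h0 hθ.2
      have : 2 / π * θ ≥ 1 / 2 := by
        rw [ge_iff_le, div_mul_eq_mul_div, le_div_iff₀ (by linarith)]
        linarith [hθ.1]
      linarith
    have a3 : u0 / 2 ≤ U θ := by linarith [hθ.1]
    nlinarith
  rw [intervalIntegral.integral_const] at hlow
  simp only [smul_eq_mul] at hlow
  have hb := c.β_le 0
  have hle : π / 2 * d * py (uu γ s ψ) 0 0 ≤ 2 * (d * s) := by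
    have : d * py (uu γ s ψ) 0 0 ≤ d * s := mul_le_mul_of_nonneg_left hb hd.le
    have : 0 ≤ d * py (uu γ s ψ) 0 0 := mul_nonneg hd.le (c.β_nonneg 0)
    nlinarith
  have : (∫ θ in (0:ℝ)..π, U θ * sin θ) = π / 2 * d * py (uu γ s ψ) 0 0 := hH
  nlinarith

theorem u0_small (c : Ctx γ s d k d0 ψ η) : uu γ s ψ 0 d ≤ 1 / 3200 := by
  have h := c.u0_sq
  have hs := c.s_small
  have h1 : d * s ≤ 1 / 10 ^ 9 := by
    have := c.d_le; have := c.d0_small; have := c.hs; have := c.hd; nlinarith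
  by_contra hlt
  push Not at hlt
  nlinarith

theorem ζ0_le (c : Ctx γ s d k d0 ψ η) : η 0 - d ≤ d / 400 := by
  have hd := c.hd
  have hγ := c.γ0
  have hk := c.k0
  have hu0 := c.u0_small
  have hu0n : 0 ≤ uu γ s ψ 0 d := c.u_nonneg 0 d hd.le (c.dlt 0).le
  have hz : 0 < η 0 - d := by linarith [c.dlt 0]
  have hM := c.M_eq 0
  have hcont : Continuous (fun y => py (uu γ s ψ) 0 y * py (uu γ s ψ) 0 y) :=
    (c.smu.py.contY 0).mul (c.smu.py.contY 0)
  have hM0 : MM γ s ψ η 0 = ∫ y in (0:ℝ)..η 0, py (uu γ s ψ) 0 y * py (uu γ s ψ) 0 y := by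
    unfold MM
    apply intervalIntegral.integral_congr
    intro y _
    simp [c.pxu, c.px0]
  have hsub : ∫ y in d..η 0, py (uu γ s ψ) 0 y * py (uu γ s ψ) 0 y ≤ MM γ s ψ η 0 := by
    rw [hM0]
    apply intervalIntegral.integral_mono_interval hd.le (by linarith) le_rfl
    · exact Filter.Eventually.of_forall fun y => mul_self_nonneg _
    · exact hcont.intervalIntegrable _ _
  set A := γ * η 0 + s with hA
  have hc2 : Continuous (fun y => (γ * y + s) ^ 2 - 2 * A * py ψ 0 y) := by
    have := c.hψ.py.contY 0
    fun_prop
  have hlow : ∫ y in d..η 0, ((γ * y + s) ^ 2 - 2 * A * py ψ 0 y) ≤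
      ∫ y in d..η 0, py (uu γ s ψ) 0 y * py (uu γ s ψ) 0 y := by
    apply intervalIntegral.integral_mono_on (by linarith) (hc2.intervalIntegrable _ _)
      (hcont.intervalIntegrable _ _)
    intro y hy
    rw [c.pyu]
    have h1 := c.uni 0 y (hd.le.trans hy.1) hy.2
    have h2 : γ * y + s ≤ A := by rw [hA]; have := mul_le_mul_of_nonneg_left hy.2 hγ.le; linarith
    nlinarith [mul_le_mul_of_nonneg_right h2 h1, sq_nonneg (py ψ 0 y)]
  have hftc : ∫ y in d..η 0, ((γ * y + s) ^ 2 - 2 * A * py ψ 0 y) =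
      ((γ ^ 2 / 3 * η 0 ^ 3 + γ * s * η 0 ^ 2 + s ^ 2 * η 0) - 2 * A * ψ 0 (η 0)) -
      ((γ ^ 2 / 3 * d ^ 3 + γ * s * d ^ 2 + s ^ 2 * d) - 2 * A * ψ 0 d) := by
    apply intervalIntegral.integral_eq_sub_of_hasDerivAt
      (f := fun y => (γ ^ 2 / 3 * y ^ 3 + γ * s * y ^ 2 + s ^ 2 * y) - 2 * A * ψ 0 y)
    · intro y _
      refine (((((hasDerivAt_pow 3 y).const_mul (γ ^ 2 / 3)).add
        ((hasDerivAt_pow 2 y).const_mul (γ * s))).add ((hasDerivAt_id y).const_mul (s ^ 2))).sub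
        ((c.hψ.dy 0 y).const_mul (2 * A))).congr_deriv ?_
      simp; ring
    · exact hc2.intervalIntegrable _ _
  have hu0e : ψ 0 d = 1 - uu γ s ψ 0 d := by rw [uu]; have := c.e1; linarith
  rw [c.surf, hu0e] at hftc
  have hkk := c.hk
  set u0 := uu γ s ψ 0 d with hu0d
  set z := η 0 - d with hzd
  have hη : η 0 = d + z := by rw [hzd]; ring
  have hsk : s = k - γ * d := by linarith
  have key : k ^ 2 * z - 2 * (k + γ * z) * u0 ≤ z ^ 2 := by
    have h3 := hlow.trans hsub
    rw [hftc, hM, hA, hη, hsk] at h3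
    nlinarith
  have hzk : 2 * z ≤ k ^ 2 := by
    have := c.bern 0
    nlinarith [sq_nonneg (px ψ 0 (η 0)), sq_nonneg (py ψ 0 (η 0))]
  have hk2 := c.k2
  have h5 : k * (k * z) ≤ k * (8 * u0) := by
    have b0 : 2 * γ ≤ k ^ 2 := by linarith [sq_nonneg s]
    have a1 : 2 * z * z ≤ k ^ 2 * z := mul_le_mul_of_nonneg_right hzk hz.le
    have a2 : γ * z * u0 ≤ γ * z * (1 / 8) :=
      mul_le_mul_of_nonneg_left (by linarith) (by positivity)
    have a3 : 2 * γ * z ≤ k ^ 2 * z := mul_le_mul_of_nonneg_right b0 hz.le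
    have a4 : k ^ 2 * z - 2 * (k * u0) - 2 * (γ * z * u0) ≤ z * z := by
      have : k ^ 2 * z - 2 * (k * u0) - 2 * (γ * z * u0) - z * z
        = k ^ 2 * z - 2 * (k + γ * z) * u0 - z ^ 2 := by ring
      linarith
    have e1 : k * (k * z) = k ^ 2 * z := by ring
    have e2 : k * (8 * u0) = 8 * (k * u0) := by ring
    rw [e1, e2]
    have e3 : 2 * z * z = 2 * (z * z) := by ring
    have e4 : 2 * γ * z = 2 * (γ * z) := by ring
    have e5 : γ * z * (1 / 8) = (γ * z) / 8 := by ring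
    rw [e3] at a1
    rw [e4] at a3
    rw [e5] at a2
    have a6 : 0 ≤ k ^ 2 * z := by positivity
    linarith
  have h6 : k * z ≤ 8 * u0 := le_of_mul_le_mul_left h5 hk
  have h7 := c.kd_ge
  nlinarith [mul_le_mul_of_nonneg_left h7 hz.le, mul_le_mul_of_nonneg_left h6 hd.le]

theorem ζ_le (c : Ctx γ s d k d0 ψ η) (x : ℝ) : η x - d ≤ d / 400 := by
  have := c.ζ0_le; have := c.ηle x; linarith

theorem G_le (c : Ctx γ s d k d0 ψ η) (x : ℝ) : 2 * d - s * TT ψ η x + s * γ * (η x - d) / 2 ≤ 2 * max (η x - d0) 0 := by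
  have hT0 := c.T_nonneg x
  have hT := c.T_sq x
  rw [c.k2] at hT
  set T := TT ψ η x
  have hγ := c.γ0
  have hs := c.hs
  have hd0 := c.hd0
  have e2 := c.e2
  have e3 := c.e3
  have e4 := c.e4
  have hd01 := c.d0_small
  have hz := c.ζ_le x
  have hd := c.d_le
  rcases le_total (η x) d0 with h | h
  · rw [max_eq_right (by linarith)]
    have h1 : γ * d0 ≤ T := by
      refine le_of_sq_le_sq2 ?_ hT0
      nlinarith
    have h2 := mul_le_mul_of_nonneg_left h1 hs.le
    have h3 : s * γ * (η x) ≤ s * γ * d0 := mul_le_mul_of_nonneg_left h (by positivity)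
    nlinarith
  · rw [max_eq_left (by linarith)]
    set t := η x - d0 with ht
    have ht0 : 0 ≤ t := by rw [ht]; linarith
    have ht1 : t ≤ 1 := by rw [ht]; have := c.hd; linarith
    have hη : η x = d0 + t := by rw [ht]; ring
    have h1 : d0 * (γ - t) ≤ T := by
      refine le_of_sq_le_sq2 ?_ hT0
      rw [hη] at hT
      have a1 : d0 ^ 2 * t ≤ 2 := by nlinarith [sq_nonneg d0]
      have a2 : d0 ^ 2 * t * t ≤ 2 * t := mul_le_mul_of_nonneg_right a1 ht0
      have a3 : (d0 * (γ - t)) ^ 2 = γ * (γ * d0 ^ 2) - 2 * t * (γ * d0 ^ 2) + d0 ^ 2 * t * t := by ring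
      rw [a3, e3]
      linarith
    have h2 := mul_le_mul_of_nonneg_left h1 hs.le
    have hsγ := c.sγ
    have hss := c.s_small
    rw [hη]
    have a4 : s * γ * t ≤ 2 * t := mul_le_mul_of_nonneg_right hsγ ht0
    have a5 : s * d0 * t ≤ 1 * t := mul_le_mul_of_nonneg_right (by nlinarith) ht0
    nlinarith

/-- the combined functional -/
theorem W_deriv (c : Ctx γ s d k d0 ψ η) (x : ℝ) : ∃ w, HasDerivAt (fun x => 2 * d * NN ψ η x + s * EE γ s d ψ η x) w x ∧
    w ≤ - (d * (py (uu γ s ψ) x 0 * (s - py (uu γ s ψ) x 0))) + d / 200 * max (η x - d0) 0 := by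
  refine ⟨_, ((c.N_deriv x).const_mul (2 * d)).add ((c.E_deriv x).const_mul s), ?_⟩
  have hG := c.G_le x
  have hz := c.ζ_le x
  have hz0 : 0 < η x - d := by linarith [c.dlt x]
  have ht : 0 ≤ max (η x - d0) 0 := le_max_right _ _
  have h1 := mul_le_mul_of_nonneg_left hG hz0.le
  have h2 := mul_le_mul_of_nonneg_right hz ht
  nlinarith

end Ctx



theorem mvt_le {f f' : ℝ → ℝ} {a b C : ℝ} (hab : a ≤ b) (hf : ∀ x, HasDerivAt f (f' x) x)
    (h : ∀ x, a < x → x < b → f' x ≤ C) : f b - f a ≤ C * (b - a) := by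
  rcases hab.eq_or_lt with rfl | hlt
  · simp
  · obtain ⟨x, hx, he⟩ := exists_hasDerivAt_eq_slope f f' hlt
      (fun y _ => (hf y).continuousAt.continuousWithinAt) (fun y _ => hf y)
    have h1 := h x hx.1 hx.2
    have h2 : 0 < b - a := by linarith
    rw [he, div_le_iff₀ h2] at h1
    exact h1

namespace Ctx
variable {γ s d k d0 : ℝ} {ψ : ℝ → ℝ → ℝ} {η : ℝ → ℝ}

theorem W_lim (c : Ctx γ s d k d0 ψ η) : ∀ ε > 0, ∃ X, 0 < X ∧ ∀ x, X ≤ x →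
    -ε ≤ 2 * d * NN ψ η x + s * EE γ s d ψ η x ∧ NN ψ η x ≤ ε := by
  intro ε hε
  have hd := c.hd
  have hs := c.hs
  have hp : 0 < 2 * d + s + 1 := by linarith
  obtain ⟨X, hX, h⟩ := c.flux_lim (ε / (2 * d + s + 1)) (by positivity)
  refine ⟨X, hX, fun x hx => ?_⟩
  obtain ⟨h1, h2, -, -⟩ := h x hx
  set e := ε / (2 * d + s + 1) with he
  have he0 : 0 < e := by positivity
  have hee : ε = (2 * d + s + 1) * e := by rw [he]; field_simp
  have h3 := (abs_le.1 h1).1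
  have h4 := abs_le.1 h2
  have h5 := mul_le_mul_of_nonneg_left h3 hs.le
  have h6 := mul_le_mul_of_nonneg_left h4.1 (by linarith : 0 ≤ 2 * d)
  have h7 : 0 ≤ d * e := by positivity
  have h8 : 0 ≤ s * e := by positivity
  constructor
  · rw [hee]; linarith
  · rw [hee]; linarith

theorem case1 (c : Ctx γ s d k d0 ψ η) (h : py (uu γ s ψ) 0 0 ≤ s / 2) : False := by
  have hd := c.hd
  have hs := c.hs
  have hdd := c.d_le
  choose w hw1 hw2 using c.W_deriv
  have hΦ : ∀ x, HasDerivAt (fun x => (2 * d * NN ψ η x + s * EE γ s d ψ η x) - d / 2 * NN ψ η x)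
      (w x - d / 2 * ((η x - d) - s * py (uu γ s ψ) x 0 + py (uu γ s ψ) x 0 ^ 2 / 2)) x :=
    fun x => (hw1 x).sub ((c.N_deriv x).const_mul (d / 2))
  have hb : ∀ x, 0 ≤ x →
      w x - d / 2 * ((η x - d) - s * py (uu γ s ψ) x 0 + py (uu γ s ψ) x 0 ^ 2 / 2) ≤
      - (d / 4 * (η x - d)) := by
    intro x hx
    have h1 := c.β_anti 0 x le_rfl hx
    have h2 := c.β_nonneg x
    have h3 := hw2 x
    set b := py (uu γ s ψ) x 0
    have h4 : max (η x - d0) 0 ≤ η x - d := max_le (by linarith) (by linarith [c.dlt x])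
    have h5 : s * b / 2 ≤ b * (s - b) := by nlinarith
    have h6 := mul_le_mul_of_nonneg_left h5 hd.le
    have h7 := mul_le_mul_of_nonneg_left h4 (by linarith : 0 ≤ d / 200)
    have h8 : 0 ≤ d * (b ^ 2) := by positivity
    have h9 : 0 ≤ d * (η x - d) := mul_nonneg hd.le (by linarith [c.dlt x])
    nlinarith
  have hz1 : 0 < η 1 - d := by linarith [c.dlt 1]
  have m1 := mvt_le (C := - (d / 4 * (η 1 - d))) (zero_le_one' ℝ) hΦ (by
    intro x h0 h1
    refine (hb x h0.le).trans ?_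
    have := c.anti x 1 h0.le h1.le
    have := mul_le_mul_of_nonneg_left this (by linarith : 0 ≤ d / 4)
    linarith)
  simp only [c.E_zero, c.N_zero] at m1
  have hp : 0 < d / 4 * (η 1 - d) := by positivity
  set p := d / 4 * (η 1 - d) with hpd
  obtain ⟨X, hX, hlim⟩ := c.W_lim (p / (2 * (1 + d))) (by positivity)
  set e := p / (2 * (1 + d)) with he
  have he0 : 0 < e := by positivity
  have hee : p = 2 * (1 + d) * e := by rw [he]; field_simp
  obtain ⟨l1, l2⟩ := hlim (max X 1) (le_max_left _ _)
  have m2 := mvt_le (C := 0) (le_max_right X 1) hΦ (by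
    intro x h0 h1
    refine (hb x (by linarith)).trans ?_
    have : 0 ≤ d / 4 * (η x - d) := mul_nonneg (by linarith) (by linarith [c.dlt x])
    linarith)
  have l3 := mul_le_mul_of_nonneg_left l2 (by linarith : 0 ≤ d / 2)
  have : 0 < d * e := by positivity
  linarith

theorem exists_x0 (c : Ctx γ s d k d0 ψ η) : ∃ x0, 0 ≤ x0 ∧ η x0 ≤ d0 ∧ ∀ x, 0 < x → x < x0 → d0 ≤ η x := by
  have hdd := c.d_le
  rcases le_total (η 0) d0 with h | h
  · exact ⟨0, le_rfl, h, fun x h1 h2 => absurd h1 (by linarith)⟩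
  · obtain ⟨X, hX, hx⟩ := c.asymu (d0 - d) (by linarith)
    have h1 := (hx X (le_abs_self X)).1
    obtain ⟨x0, hx0, he⟩ := intermediate_value_Icc' hX.le (c.ηc.continuousOn)
      (show d0 ∈ Icc (η X) (η 0) from ⟨by linarith, h⟩)
    exact ⟨x0, hx0.1, he.le, fun x h2 h3 => he ▸ c.anti x x0 h2.le h3.le⟩

theorem exists_x1 (c : Ctx γ s d k d0 ψ η) (h : s / 2 < py (uu γ s ψ) 0 0) :
    ∃ x1, 0 ≤ x1 ∧ py (uu γ s ψ) x1 0 = s / 2 := by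
  have hs := c.hs
  obtain ⟨X, hX, hx⟩ := c.asymu (s / 2) (by linarith)
  have h1 := ((hx X (le_abs_self X)).2 0 le_rfl (c.η0 X).le).2.2
  have hc : Continuous (fun x => py (uu γ s ψ) x 0) :=
    c.smu.py.contXY continuous_id continuous_const
  obtain ⟨x1, hx1, he⟩ := intermediate_value_Icc' hX.le hc.continuousOn
    (show s / 2 ∈ Icc _ _ from ⟨(abs_le.1 h1).2, h.le⟩)
  exact ⟨x1, hx1.1, he⟩

theorem u_x0 (c : Ctx γ s d k d0 ψ η) {x0 : ℝ} (h : η x0 ≤ d0) (y : ℝ) (h0 : 0 ≤ y) (h1 : y ≤ d) :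
    uu γ s ψ x0 y ≤ s * d0 := by
  have hlt := c.dlt x0
  have hm := mvt_le (f := fun y => - uu γ s ψ x0 y) (f' := fun y => - py (uu γ s ψ) x0 y)
    (a := y) (b := η x0) (C := 0) (by linarith) (fun t => (c.smu.dy x0 t).neg)
    (fun t h2 h3 => by have := c.uy_nonneg x0 t (by linarith) h3.le; linarith)
  simp only [c.usurf] at hm
  have hk := c.k0
  have hγ := c.γ0
  have e1 := c.e1
  have e3 := c.e3
  have hkk := c.hk
  have h4 : k * (η x0 - d) ≤ k * (d0 - d) := mul_le_mul_of_nonneg_left (by linarith) hk.le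
  have h5 : γ * (η x0 - d) ^ 2 ≤ γ * (d0 - d) ^ 2 :=
    mul_le_mul_of_nonneg_left (pow_le_pow_left₀ (by linarith) (by linarith) 2) hγ.le
  have h6 : k * (d0 - d) + γ * (d0 - d) ^ 2 / 2 = s * d0 := by
    rw [hkk]; linear_combination e3 / 2 - e1
  linarith

theorem exists_X (c : Ctx γ s d k d0 ψ η) {x0 : ℝ} (hx0 : 0 ≤ x0) (h : η x0 ≤ d0) :
    ∃ X, x0 < X ∧ X < x0 + d ∧ - (s * d0 * d / 2) ≤ EE γ s d ψ η X := by
  have hd := c.hd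
  have hF : Sm (fun x y => (d - y) * uu γ s ψ x y) :=
    (Sm.ofY (g := fun y => d - y) (by fun_prop)).mul c.smu
  have hF' : Sm (fun x y => (d - y) * px (uu γ s ψ) x y) :=
    (Sm.ofY (g := fun y => d - y) (by fun_prop)).mul c.smu.px
  have hq : ∀ x, HasDerivAt (fun x => ∫ y in (0:ℝ)..d, (d - y) * uu γ s ψ x y)
      (∫ y in (0:ℝ)..d, (d - y) * px (uu γ s ψ) x y) x := fun x =>
    param_deriv (F := fun x y => (d - y) * uu γ s ψ x y)
      (F' := fun x y => (d - y) * px (uu γ s ψ) x y) hF.cont hF'.cont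
      (fun x t => (c.smu.dx x t).const_mul (d - t)) 0 d x
  obtain ⟨X, hX, he⟩ := exists_hasDerivAt_eq_slope _ _ (by linarith : x0 < x0 + d)
      (fun y _ => (hq y).continuousAt.continuousWithinAt) (fun y _ => hq y)
  refine ⟨X, hX.1, hX.2, ?_⟩
  have q1 : 0 ≤ ∫ y in (0:ℝ)..d, (d - y) * uu γ s ψ (x0 + d) y := by
    apply intervalIntegral.integral_nonneg hd.le
    intro y hy
    exact mul_nonneg (by linarith [hy.2])
      (c.u_nonneg _ _ hy.1 (hy.2.trans (c.dlt _).le))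
  have q2 : ∫ y in (0:ℝ)..d, (d - y) * uu γ s ψ x0 y ≤ ∫ y in (0:ℝ)..d, (d - y) * (s * d0) := by
    apply intervalIntegral.integral_mono_on hd.le ((hF.contY x0).intervalIntegrable _ _)
      ((by fun_prop : Continuous fun y => (d - y) * (s * d0)).intervalIntegrable _ _)
    intro y hy
    exact mul_le_mul_of_nonneg_left (c.u_x0 h y hy.1 hy.2) (by linarith [hy.2])
  have q3 : ∫ y in (0:ℝ)..d, (d - y) * (s * d0) = s * d0 * d ^ 2 / 2 := by
    rw [intervalIntegral.integral_mul_const, intervalIntegral.integral_sub (by simp) (by simp)]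
    simp
    ring
  have q4 : - (s * d0 * d / 2) ≤ ∫ y in (0:ℝ)..d, (d - y) * px (uu γ s ψ) X y := by
    rw [he, le_div_iff₀ (by linarith)]
    have : -(s * d0 * d / 2) * (x0 + d - x0) = - (s * d0 * d ^ 2 / 2) := by ring
    rw [this]
    linarith
  refine q4.trans ?_
  unfold EE
  rw [← intervalIntegral.integral_add_adjacent_intervals
    ((hF'.contY X).intervalIntegrable 0 d) ((hF'.contY X).intervalIntegrable d (η X))]
  have : 0 ≤ ∫ y in d..η X, (d - y) * px (uu γ s ψ) X y := by
    apply intervalIntegral.integral_nonneg (c.dlt X).le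
    intro y hy
    rw [c.pxu]
    have := c.psix_nonneg X y (by linarith [hX.1]) (hd.le.trans hy.1) hy.2
    exact mul_nonneg_of_nonpos_of_nonpos (by linarith [hy.1]) (by linarith)
  linarith

theorem case2 (c : Ctx γ s d k d0 ψ η) (h : s / 2 < py (uu γ s ψ) 0 0) : False := by
  have hd := c.hd
  have hs := c.hs
  have hdd := c.d_le
  have hd0 := c.d0_le
  have e2 := c.e2
  choose w hw1 hw2 using c.W_deriv
  have htc : Continuous (fun x => max (η x - d0) 0) := by
    have := c.ηc
    fun_prop
  have hA : ∀ x, HasDerivAt (fun x => ∫ y in (0:ℝ)..x, max (η y - d0) 0) (max (η x - d0) 0) x :=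
    fun x => (htc.integral_hasStrictDerivAt 0 x).hasDerivAt
  set A : ℝ → ℝ := fun x => ∫ y in (0:ℝ)..x, max (η y - d0) 0 with hAd
  have A0 : A 0 = 0 := by simp [hAd]
  have hV : ∀ x, HasDerivAt (fun x => (2 * d * NN ψ η x + s * EE γ s d ψ η x) - d / 200 * A x)
      (w x - d / 200 * max (η x - d0) 0) x := fun x => (hw1 x).sub ((hA x).const_mul (d / 200))
  set V : ℝ → ℝ := fun x => (2 * d * NN ψ η x + s * EE γ s d ψ η x) - d / 200 * A x with hVd
  have V0 : V 0 = 0 := by simp only [hVd, c.E_zero, c.N_zero, A0]; ring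
  have hV' : ∀ x, w x - d / 200 * max (η x - d0) 0 ≤
      - (d * (py (uu γ s ψ) x 0 * (s - py (uu γ s ψ) x 0))) := fun x => by linarith [hw2 x]
  have hV'0 : ∀ x, w x - d / 200 * max (η x - d0) 0 ≤ 0 := fun x => by
    have := mul_nonneg hd.le (mul_nonneg (c.β_nonneg x) (sub_nonneg.2 (c.β_le x)))
    linarith [hV' x]
  have hVm : ∀ x y, x ≤ y → V y ≤ V x := fun x y hxy => by
    have := mvt_le (C := 0) hxy hV (fun t _ _ => hV'0 t)
    linarith
  obtain ⟨x0, hx0, hη0, hη1⟩ := c.exists_x0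
  obtain ⟨x1, hx1, hβ1⟩ := c.exists_x1 h
  obtain ⟨X, hX0, hX1, hE⟩ := c.exists_X hx0 hη0
  have hAx : ∀ x, x0 ≤ x → A x ≤ A x0 := fun x hx => by
    have := mvt_le (C := 0) hx hA (fun t h1 _ => by
      have := c.anti x0 t hx0 h1.le
      exact max_le (by linarith) le_rfl)
    linarith
  have hNA : A x0 ≤ NN ψ η x0 := by
    have := mvt_le (C := 0) hx0 (fun x => (hA x).sub (c.N_deriv x)) (fun t h1 h2 => by
      have := hη1 t h1 h2
      rw [max_eq_left (by linarith)]
      nlinarith [sq_nonneg (s - py (uu γ s ψ) t 0)])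
    simp only [Pi.sub_apply, A0, c.N_zero] at this
    linarith
  have hNX : NN ψ η x0 - s ^ 2 / 2 * (X - x0) ≤ NN ψ η X := by
    have := mvt_le (C := s ^ 2 / 2) hX0.le (fun x => (c.N_deriv x).neg) (fun t h1 h2 => by
      have := c.dlt t
      nlinarith [sq_nonneg (s - py (uu γ s ψ) t 0)])
    simp only [Pi.neg_apply] at this
    linarith
  have hVX : V X ≤ 0 := V0 ▸ hVm 0 X (by linarith)
  have hAX := hAx X hX0.le
  have hA1 : A x0 ≤ s ^ 2 * d0 := by
    have i1 : 2 * d * NN ψ η X + s * EE γ s d ψ η X ≤ d / 200 * A x0 := by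
      have := mul_le_mul_of_nonneg_left hAX (by linarith : 0 ≤ d / 200)
      simp only [hVd] at hVX
      linarith
    have i2 := mul_le_mul_of_nonneg_left hE hs.le
    have i3 : d * NN ψ η X ≤ d * (A x0 / 400 + s ^ 2 * d0 / 4) := by
      have e : s * -(s * d0 * d / 2) = - (d * (s ^ 2 * d0) / 2) := by ring
      rw [e] at i2
      linarith
    have i4 := le_of_mul_le_mul_left i3 hd
    have i5 : s ^ 2 / 2 * (X - x0) ≤ s ^ 2 / 2 * d0 :=
      mul_le_mul_of_nonneg_left (by linarith) (by positivity)
    have i6 : 0 ≤ s ^ 2 * d0 := mul_nonneg (sq_nonneg s) (by linarith)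
    linarith
  -- the region near x1
  have hβd : ∀ x, HasDerivAt (fun x => py (uu γ s ψ) x 0) (px (py (uu γ s ψ)) x 0) x :=
    fun x => c.smu.py.dx x 0
  have hβx : ∀ x, x1 ≤ x → x ≤ x1 + d / 8 → s / 4 ≤ py (uu γ s ψ) x 0 := by
    intro x h1 h2
    have := mvt_le (C := 2 * s / d) h1 (fun x => (hβd x).neg) (fun t h3 h4 => by
      rw [le_div_iff₀ hd]
      have i1 := c.β_harnack t
      have i2 := c.β_anti x1 t hx1 h3.le
      have i3 := mul_le_mul_of_nonneg_right (neg_le_abs (px (py (uu γ s ψ)) t 0)) hd.le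
      linarith)
    simp only [Pi.neg_apply, hβ1] at this
    have i4 : 2 * s / d * (x - x1) ≤ 2 * s / d * (d / 8) :=
      mul_le_mul_of_nonneg_left (by linarith) (by positivity)
    have i5 : 2 * s / d * (d / 8) = s / 4 := by field_simp; norm_num
    linarith
  have hV1 : V (x1 + d / 8) ≤ - (d * (s ^ 2 / 8) * (d / 8)) := by
    have := mvt_le (a := x1) (b := x1 + d / 8) (C := - (d * (s ^ 2 / 8))) (by linarith) hV
      (fun t h1 h2 => by
        refine (hV' t).trans ?_
        have i1 := hβx t h1.le h2.le
        have i2 := c.β_anti x1 t hx1 h1.le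
        have i3 : s ^ 2 / 8 ≤ py (uu γ s ψ) t 0 * (s - py (uu γ s ψ) t 0) := by nlinarith
        have := mul_le_mul_of_nonneg_left i3 hd.le
        linarith)
    have i0 : V x1 ≤ 0 := V0 ▸ hVm 0 x1 hx1
    have : x1 + d / 8 - x1 = d / 8 := by ring
    simp_all only
    linarith
  have hpos : 0 < d * (d * s ^ 2) := by positivity
  obtain ⟨Y, hY, hlim⟩ := c.W_lim (d * (d * s ^ 2) / 1000) (by positivity)
  set Z := max Y (max x0 (x1 + d / 8))
  have l1 := (hlim Z (le_max_left _ _)).1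
  have l2 := hVm (x1 + d / 8) Z ((le_max_right _ _).trans (le_max_right _ _))
  have l3 := hAx Z ((le_max_left _ _).trans (le_max_right _ _))
  have l4 : d / 200 * A Z ≤ d / 200 * (s ^ 2 * (2 * d)) := by
    refine mul_le_mul_of_nonneg_left ?_ (by linarith)
    have := mul_le_mul_of_nonneg_left hd0 (sq_nonneg s)
    linarith
  have l5 : V Z = (2 * d * NN ψ η Z + s * EE γ s d ψ η Z) - d / 200 * A Z := rfl
  have l6 : d * (s ^ 2 / 8) * (d / 8) = d * (d * s ^ 2) / 64 := by ring
  have l7 : d / 200 * (s ^ 2 * (2 * d)) = d * (d * s ^ 2) / 100 := by ring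
  rw [l6] at hV1
  rw [l7] at l4
  linarith

theorem contra (c : Ctx γ s d k d0 ψ η) : False := by
  rcases le_or_gt (py (uu γ s ψ) 0 0) (s / 2) with h | h
  · exact c.case1 h
  · exact c.case2 h

end Ctx


/-- Theorem 4.1 (solitary case): for large `γ` there is no unidirectional solitary wave
with Bernoulli constant `r = R(0) = γ + √(2/γ)`. -/
theorem no_solitary_with_maximal_bernoulli :
    ∃ γ₀ > (0 : ℝ), ∀ γ > γ₀, ∀ sc : ℝ, IsCrit γ sc →
      ∀ (ψ : ℝ → ℝ → ℝ) (η : ℝ → ℝ) (r : ℝ),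
        SolitaryWave γ sc ψ η r → Unidirectional ψ η →
        r ≠ γ + Real.sqrt (2 / γ) := by
  refine ⟨10 ^ 10, by norm_num, ?_⟩
  intro γ hγ sc hsc ψ η r hw hu hr
  obtain ⟨s, d, k, d0, c⟩ := Ctx.of hγ hsc hw hu hr
  exact c.contra
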